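/- For every compact set K ⊆ ℂⁿ, the essential hull of K is contained in the polynomial hull of the trace of K: ess(K) ⊆ (trc(K))^. -/

import Mathlib

noncomputable section

/-- The polynomial hull of a set `K ⊆ ℂⁿ`: all points `z` with
`|P(z)| ≤ sup_{w ∈ K} |P(w)|` for every holomorphic polynomial `P` in `n` variables. -/
def polyHull (n : ℕ) (K : Set (Fin n → ℂ)) : Set (Fin n → ℂ) :=
  {z | ∀ P : MvPolynomial (Fin n) ℂ,
    ‖MvPolynomial.eval z P‖ ≤ sSup ((fun w => ‖MvPolynomial.eval w P‖) '' K)}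

/-- The essential hull `ess(K) = closure(K̂ \ K)`. -/
def essHull (n : ℕ) (K : Set (Fin n → ℂ)) : Set (Fin n → ℂ) :=
  closure (polyHull n K \ K)

/-- The trace `trc(K) = ess(K) ∩ K`. -/
def trc (n : ℕ) (K : Set (Fin n → ℂ)) : Set (Fin n → ℂ) :=
  essHull n K ∩ K

section hullTrace

open Complex MeasureTheory
open scoped ContDiff

/-- Twice the Wirtinger derivative `∂/∂z̄ᵢ`. -/
def dbar {n : ℕ} (i : Fin n) (f : (Fin n → ℂ) → ℂ) (x : Fin n → ℂ) : ℂ :=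
  fderiv ℝ f x (Pi.single i 1) + I * fderiv ℝ f x (Pi.single i I)

section dbar

variable {n : ℕ} (i j : Fin n) {f g : (Fin n → ℂ) → ℂ} {x : Fin n → ℂ}

lemma dbar_add (hf : DifferentiableAt ℝ f x) (hg : DifferentiableAt ℝ g x) :
    dbar i (fun y => f y + g y) x = dbar i f x + dbar i g x := by
  simp only [dbar, fderiv_fun_add hf hg, add_apply]; ring

lemma dbar_mul (hf : DifferentiableAt ℝ f x) (hg : DifferentiableAt ℝ g x) :
    dbar i (fun y => f y * g y) x = dbar i f x * g x + f x * dbar i g x := by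
  simp only [dbar, fderiv_fun_mul hf hg, add_apply,
    smul_apply, smul_eq_mul]; ring

@[simp] lemma dbar_const (c : ℂ) : dbar i (fun _ => c) x = 0 := by
  simp [dbar]

lemma dbar_sum {ι : Type*} (s : Finset ι) {F : ι → (Fin n → ℂ) → ℂ}
    (hF : ∀ k ∈ s, DifferentiableAt ℝ (F k) x) :
    dbar i (fun y => ∑ k ∈ s, F k y) x = ∑ k ∈ s, dbar i (F k) x := by
  simp only [dbar, fderiv_fun_sum hF, sum_apply, Finset.mul_sum,
    Finset.sum_add_distrib]

lemma dbar_congr (h : f =ᶠ[nhds x] g) : dbar i f x = dbar i g x := by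
  simp only [dbar, h.fderiv_eq]

lemma dbar_eq_zero (hf : DifferentiableAt ℂ f x) : dbar i f x = 0 := by
  have h : (Pi.single i I : Fin n → ℂ) = I • Pi.single i 1 := by
    rw [← Pi.single_smul]; simp
  simp only [dbar, hf.fderiv_restrictScalars ℝ, ContinuousLinearMap.coe_restrictScalars', h,
    map_smul, smul_eq_mul, ← mul_assoc, I_mul_I]
  ring

lemma dbar_eq_zero_of_notMem_tsupport (hx : x ∉ tsupport f) : dbar i f x = 0 := by
  rw [dbar_congr i (notMem_tsupport_iff_eventuallyEq.1 hx)]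
  exact dbar_const i 0

lemma dbar_inv_pow (hf : DifferentiableAt ℝ f x) (hx : f x ≠ 0) (m : ℕ) :
    dbar i (fun y => (f y)⁻¹ ^ m) x = -(m * (f x)⁻¹ ^ (m + 1) * dbar i f x) := by
  have h1 : HasFDerivAt (fun y => (f y)⁻¹ ^ m)
      ((m * (f x)⁻¹ ^ (m - 1) * (-((f x) ^ 2)⁻¹)) • fderiv ℝ f x) x := by
    have h2 : HasDerivAt (fun w : ℂ => w⁻¹ ^ m) (m * (f x)⁻¹ ^ (m - 1) * (-((f x) ^ 2)⁻¹)) (f x) :=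
      (hasDerivAt_inv hx).pow m
    exact h2.comp_hasFDerivAt x hf.hasFDerivAt
  simp only [dbar, h1.fderiv, smul_apply, smul_eq_mul]
  rcases m with _ | m
  · simp
  · simp only [Nat.add_sub_cancel]
    push_cast
    have e : ((f x) ^ 2)⁻¹ = (f x)⁻¹ ^ 2 := by rw [inv_pow]
    rw [e]
    ring

lemma dbar_conj_coord (k : Fin n) :
    dbar i (fun y => (starRingEnd ℂ) (y k)) x = if i = k then 2 else 0 := by
  have h : HasFDerivAt (fun y : Fin n → ℂ => (starRingEnd ℂ) (y k))
      ((conjCLE : ℂ →L[ℝ] ℂ).comp (ContinuousLinearMap.proj k)) x :=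
    ((conjCLE : ℂ →L[ℝ] ℂ).comp
      (ContinuousLinearMap.proj (R := ℝ) (φ := fun _ : Fin n => ℂ) k)).hasFDerivAt
  simp only [dbar, h.fderiv]
  by_cases hik : i = k
  · subst hik; simp; norm_num
  · simp [hik, Ne.symm hik]

open scoped ContDiff

lemma ContDiff.dbar (hf : ContDiff ℝ ∞ f) : ContDiff ℝ ∞ (dbar i f) := by
  have h : ContDiff ℝ ∞ (fderiv ℝ f) := hf.fderiv_right (by simp)
  unfold _root_.dbar
  fun_prop

lemma ContDiff.dbar_param {E : Type*} [NormedAddCommGroup E] [NormedSpace ℝ E]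
    {F : (Fin n → ℂ) → E → ℂ}
    (hF : ContDiff ℝ ∞ (Function.uncurry F)) :
    ContDiff ℝ ∞ (Function.uncurry fun x z => _root_.dbar i (fun y => F y z) x) := by
  have h : ContDiff ℝ ∞ (fun p : (Fin n → ℂ) × E => fderiv ℝ (fun y => F y p.2) p.1) := by
    refine ContDiff.fderiv (𝕜 := ℝ) (f := fun (p : (Fin n → ℂ) × E) y => F y p.2) (n := ∞) ?_
      contDiff_fst (m := ∞) (by simp)
    exact hF.comp (by fun_prop : ContDiff ℝ ∞ fun q : ((Fin n → ℂ) × E) × (Fin n → ℂ) =>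
      (q.2, q.1.2))
  unfold _root_.dbar Function.uncurry
  fun_prop

lemma dbar_comm (hf : ContDiff ℝ ∞ f) : dbar i (dbar j f) x = dbar j (dbar i f) x := by
  have h : ContDiff ℝ ∞ (fderiv ℝ f) := hf.fderiv_right (by simp)
  have hd : DifferentiableAt ℝ (fderiv ℝ f) x := h.contDiffAt.differentiableAt (by simp)
  have key : ∀ (i : Fin n) (v : Fin n → ℂ), fderiv ℝ (dbar i f) x v =
      fderiv ℝ (fderiv ℝ f) x v (Pi.single i 1) + I * fderiv ℝ (fderiv ℝ f) x v (Pi.single i I) := by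
    intro i v
    have h1 : ∀ w, HasFDerivAt (fun y => fderiv ℝ f y w) ((fderiv ℝ (fderiv ℝ f) x).flip w) x :=
      fun w => by simpa using hd.hasFDerivAt.clm_apply (hasFDerivAt_const w x)
    have h2 : HasFDerivAt (dbar i f) _ x := (h1 _).add ((h1 _).const_mul I)
    rw [h2.fderiv]
    simp
  have hs : IsSymmSndFDerivAt ℝ f x := hf.contDiffAt.isSymmSndFDerivAt (by
    simp only [minSmoothness_of_isRCLikeNormedField]; exact WithTop.coe_le_coe.2 (le_top : (2 : ℕ∞) ≤ ⊤))
  have e : ∀ i j, dbar i (dbar j f) x = fderiv ℝ (dbar j f) x (Pi.single i 1) +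
    I * fderiv ℝ (dbar j f) x (Pi.single i I) := fun _ _ => rfl
  rw [e, e, key, key, key, key, hs (Pi.single i 1) (Pi.single j 1), hs (Pi.single i 1) (Pi.single j I),
    hs (Pi.single i I) (Pi.single j 1), hs (Pi.single i I) (Pi.single j I)]
  ring

lemma dbar_det {m : ℕ} {M : (Fin n → ℂ) → Matrix (Fin m) (Fin m) ℂ}
    (hM : ∀ k l, DifferentiableAt ℝ (fun y => M y k l) x) :
    dbar i (fun y => (M y).det) x =
      ∑ l, ((M x).updateRow l fun k => dbar i (fun y => M y l k) x).det := by
  let D : ContinuousMultilinearMap ℝ (fun _ : Fin m => Fin m → ℂ) ℂ :=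
    { toMultilinearMap := (Matrix.detRowAlternating (R := ℂ) (n := Fin m)).toMultilinearMap.restrictScalars ℝ
      cont := by
        change Continuous fun M : Matrix (Fin m) (Fin m) ℂ => M.det
        exact Continuous.matrix_det continuous_id }
  have hM' : HasFDerivAt (fun y => (M y : Fin m → Fin m → ℂ))
      (ContinuousLinearMap.pi fun k => ContinuousLinearMap.pi fun l =>
        fderiv ℝ (fun y => M y k l) x) x := by
    refine hasFDerivAt_pi.2 fun k => hasFDerivAt_pi.2 fun l => (hM k l).hasFDerivAt
  have h := (D.hasFDerivAt (M x)).comp x hM'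
  have e : (fun y => (M y).det) = D ∘ fun y => (M y : Fin m → Fin m → ℂ) := rfl
  have hD : ∀ (l : Fin m) (v : Fin m → ℂ), D (Function.update (M x) l v) =
    ((M x).updateRow l v).det := fun l v => rfl
  have h' : ∀ v, fderiv ℝ (D ∘ fun y => (M y : Fin m → Fin m → ℂ)) x v =
      ∑ l, ((M x).updateRow l fun k => fderiv ℝ (fun y => M y l k) x v).det := by
    intro v
    rw [h.fderiv]
    exact (ContinuousMultilinearMap.linearDeriv_apply D _ _).trans
      (Finset.sum_congr rfl fun l _ => hD l _)
  simp only [dbar, e, h', Finset.mul_sum, ← Finset.sum_add_distrib]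
  refine Finset.sum_congr rfl fun l _ => ?_
  rw [← Matrix.det_updateRow_smul, ← Matrix.det_updateRow_add]
  rfl

/-- The matrix of `dbar`-derivatives of a tuple of functions. -/
def dbarJac (s : Fin n → (Fin n → ℂ) → ℂ) (x : Fin n → ℂ) : Matrix (Fin n) (Fin n) ℂ :=
  Matrix.of fun i k => dbar i (s k) x

/-- The cofactor vector field: the determinant of `dbarJac s` with row `i` replaced by `s`. -/
def cofactorField (s : Fin n → (Fin n → ℂ) → ℂ) (i : Fin n) (x : Fin n → ℂ) : ℂ :=
  ((dbarJac s x).updateRow i fun k => s k x).det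

variable {s : Fin n → (Fin n → ℂ) → ℂ}

lemma contDiff_det {E : Type*} [NormedAddCommGroup E] [NormedSpace ℝ E] {m : ℕ}
    {M : E → Matrix (Fin m) (Fin m) ℂ} (hM : ∀ k l, ContDiff ℝ ∞ fun y => M y k l) :
    ContDiff ℝ ∞ fun y => (M y).det := by
  simp only [Matrix.det_apply']
  refine ContDiff.sum fun σ _ => contDiff_const.mul (contDiff_prod fun k _ => hM _ _)

lemma contDiff_updateRow (hs : ∀ k, ContDiff ℝ ∞ (s k)) (k l : Fin n) :
    ContDiff ℝ ∞ fun y => (dbarJac s y).updateRow i (fun k => s k y) k l := by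
  by_cases h : k = i
  · subst h; simpa using hs l
  · simpa [h, dbarJac] using (hs l).dbar k

lemma contDiff_cofactorField (hs : ∀ k, ContDiff ℝ ∞ (s k)) :
    ContDiff ℝ ∞ (cofactorField s i) :=
  contDiff_det (contDiff_updateRow i hs)

/-- The Piola identity, for `dbar`. -/
lemma sum_dbar_cofactorField (hs : ∀ k, ContDiff ℝ ∞ (s k)) :
    ∑ i, dbar i (cofactorField s i) x = n * (dbarJac s x).det := by
  let T : Fin n → Fin n → ℂ := fun i l =>
    (((dbarJac s x).updateRow i fun k => s k x).updateRow l fun k => dbar i (dbar l (s k)) x).det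
  have hanti : ∀ i l, i ≠ l → T i l = - T l i := by
    intro i l hil
    have h := Matrix.det_permute (Equiv.swap i l)
      (((dbarJac s x).updateRow l fun k => s k x).updateRow i fun k => dbar l (dbar i (s k)) x)
    rw [Equiv.Perm.sign_swap hil] at h
    simp only [T]
    rw [show ∀ a : ℂ, -a = ((-1 : ℤˣ) : ℤ) * a by simp, ← h]
    congr 1
    ext a b
    by_cases ha : a = l
    · subst ha
      simp [Matrix.updateRow_self, dbar_comm i a (hs b)]
    · by_cases ha' : a = i
      · subst ha'
        simp [Matrix.updateRow_self, Matrix.updateRow_ne hil, Matrix.updateRow_ne hil.symm]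
      · simp [Matrix.updateRow_ne ha, Matrix.updateRow_ne ha', Equiv.swap_apply_of_ne_of_ne ha' ha]
  have h1 : ∀ i, dbar i (cofactorField s i) x =
      (dbarJac s x).det + ∑ l, if i = l then 0 else T i l := by
    intro i
    have hd : ∀ k l, DifferentiableAt ℝ
        (fun y => (dbarJac s y).updateRow i (fun k => s k y) k l) x := fun k l =>
      (contDiff_updateRow i hs k l).contDiffAt.differentiableAt (by simp)
    refine (dbar_det i hd).trans ?_
    rw [← Finset.add_sum_erase _ _ (Finset.mem_univ i),
      ← Finset.add_sum_erase Finset.univ (fun l => if i = l then 0 else T i l) (Finset.mem_univ i)]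
    simp only [if_true, zero_add]
    congr 1
    · congr 1
      simp only [Matrix.updateRow_self, Matrix.updateRow_idem]
      ext a b
      by_cases ha : a = i
      · subst ha; simp [dbarJac]
      · simp [ha]
    · refine Finset.sum_congr rfl fun l hl => ?_
      have hl' : l ≠ i := Finset.ne_of_mem_erase hl
      simp only [Matrix.updateRow_ne hl', if_neg hl'.symm, T]
      rfl
  simp only [h1, Finset.sum_add_distrib, Finset.sum_const, Finset.card_univ, Fintype.card_fin,
    nsmul_eq_mul, add_eq_left]
  have h2 : ∑ i, ∑ l, (if i = l then 0 else T i l) = - ∑ i, ∑ l, if i = l then 0 else T i l := by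
    conv_rhs => rw [Finset.sum_comm]
    simp only [← Finset.sum_neg_distrib]
    refine Finset.sum_congr rfl fun i _ => Finset.sum_congr rfl fun l _ => ?_
    by_cases h : i = l
    · simp [h]
    · rw [if_neg h, if_neg (Ne.symm h), hanti i l h]
  exact self_eq_neg.1 h2

lemma cofactorField_eq_sum :
    cofactorField s i x = ∑ k, s k x * (dbarJac s x).adjugate k i := by
  rw [cofactorField, ← Matrix.det_transpose, ← Matrix.updateCol_transpose,
    ← Matrix.cramer_apply, Matrix.cramer_eq_adjugate_mulVec, ← Matrix.adjugate_transpose]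
  simp [Matrix.mulVec, dotProduct, mul_comm]

lemma sum_cofactorField_mul (u : Fin n → ℂ) :
    ∑ i, cofactorField s i x * ∑ k, dbarJac s x i k * u k =
      (dbarJac s x).det * ∑ k, s k x * u k := by
  have h2 : ∀ k l, ∑ i, (dbarJac s x).adjugate k i * dbarJac s x i l =
      if k = l then (dbarJac s x).det else 0 := by
    intro k l
    rw [← Matrix.mul_apply, Matrix.adjugate_mul]
    simp [Matrix.one_apply]
  calc _ = ∑ k, ∑ l, s k x * u l * ∑ i, (dbarJac s x).adjugate k i * dbarJac s x i l := by
        simp only [cofactorField_eq_sum, Finset.sum_mul, Finset.mul_sum]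
        rw [Finset.sum_comm]
        refine (Finset.sum_congr rfl fun k _ => Finset.sum_comm).trans ?_
        refine Finset.sum_comm.trans ?_
        refine Finset.sum_congr rfl fun k _ => Finset.sum_congr rfl fun l _ =>
          Finset.sum_congr rfl fun i _ => ?_
        ring
    _ = _ := by
        simp only [h2, mul_ite, mul_zero, Finset.sum_ite_eq, Finset.mem_univ, if_true,
          Finset.mul_sum]
        refine Finset.sum_congr rfl fun k _ => by ring

/-- Divergence of the regularised Cauchy-Fantappie kernel. -/
lemma sum_dbar_kernel (hs : ∀ k, ContDiff ℝ ∞ (s k)) (z : Fin n → ℂ) (ε : ℂ)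
    (hx : ε - ∑ k, s k x * (z k - x k) ≠ 0) :
    ∑ i, dbar i (fun y => cofactorField s i y * (ε - ∑ k, s k y * (z k - y k))⁻¹ ^ n) x =
      n * ε * (dbarJac s x).det * (ε - ∑ k, s k x * (z k - x k))⁻¹ ^ (n + 1) := by
  have hsd : ∀ k, DifferentiableAt ℝ (s k) x := fun k =>
    (hs k).contDiffAt.differentiableAt (by simp)
  have hu : ∀ k, DifferentiableAt ℂ (fun y : Fin n → ℂ => z k - y k) x := fun k => by fun_prop
  have hh : ∀ i, dbar i (fun y => ε - ∑ k, s k y * (z k - y k)) x =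
      -∑ k, dbarJac s x i k * (z k - x k) := by
    intro i
    have e : (fun y => ε - ∑ k, s k y * (z k - y k)) =
        fun y => ε + ∑ k, s k y * (y k - z k) := by
      ext y; simp only [sub_eq_add_neg, ← Finset.sum_neg_distrib]
      congr 1; refine Finset.sum_congr rfl fun k _ => by ring
    have hu' : ∀ k, DifferentiableAt ℂ (fun y : Fin n → ℂ => y k - z k) x := fun k => by fun_prop
    have hp : ∀ k, DifferentiableAt ℝ (fun y => s k y * (y k - z k)) x := fun k =>
      (hsd k).mul ((hu' k).restrictScalars ℝ)
    rw [e, dbar_add i (by fun_prop) (DifferentiableAt.fun_sum fun k _ => hp k),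
      dbar_const, dbar_sum _ _ fun k _ => hp k, zero_add, ← Finset.sum_neg_distrib]
    refine Finset.sum_congr rfl fun k _ => ?_
    rw [dbar_mul i (hsd k) ((hu' k).restrictScalars ℝ), dbar_eq_zero i (hu' k)]
    simp [dbarJac]; ring
  have hhd : DifferentiableAt ℝ (fun y => ε - ∑ k, s k y * (z k - y k)) x := by
    have : ∀ k, DifferentiableAt ℝ (fun y : Fin n → ℂ => z k - y k) x := fun k =>
      (hu k).restrictScalars ℝ
    fun_prop
  have hVd : ∀ i, DifferentiableAt ℝ (cofactorField s i) x := fun i =>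
    (contDiff_cofactorField i hs).contDiffAt.differentiableAt (by simp)
  have hterm : ∀ i, dbar i (fun y => cofactorField s i y *
      (ε - ∑ k, s k y * (z k - y k))⁻¹ ^ n) x =
      dbar i (cofactorField s i) x * (ε - ∑ k, s k x * (z k - x k))⁻¹ ^ n +
      n * (ε - ∑ k, s k x * (z k - x k))⁻¹ ^ (n + 1) *
        (cofactorField s i x * ∑ k, dbarJac s x i k * (z k - x k)) := by
    intro i
    rw [dbar_mul i (hVd i) ((hhd.fun_inv hx).fun_pow n), dbar_inv_pow i hhd hx, hh]
    ring
  simp only [hterm, Finset.sum_add_distrib, ← Finset.sum_mul, ← Finset.mul_sum,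
    sum_dbar_cofactorField hs, sum_cofactorField_mul]
  set a := ∑ k, s k x * (z k - x k)
  rw [pow_succ]
  have : (ε - a) * (ε - a)⁻¹ = 1 := mul_inv_cancel₀ hx
  linear_combination (-(n * (dbarJac s x).det * (ε - a)⁻¹ ^ n)) * this

lemma integral_mul_dbar {G F : (Fin n → ℂ) → ℂ} (hG : ContDiff ℝ ∞ G) (hGc : HasCompactSupport G)
    (hF : ContDiff ℝ ∞ F) (i : Fin n) :
    ∫ x, G x * dbar i F x = - ∫ x, dbar i G x * F x := by
  have hG' : Continuous (fderiv ℝ G) := hG.continuous_fderiv (by simp)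
  have hF' : Continuous (fderiv ℝ F) := hF.continuous_fderiv (by simp)
  have hGc' : HasCompactSupport (fderiv ℝ G) := hGc.fderiv (𝕜 := ℝ)
  have h1 : ∀ v, Integrable fun x => fderiv ℝ G x v * F x := fun v =>
    ((hG'.clm_apply continuous_const).mul hF.continuous).integrable_of_hasCompactSupport
      ((hGc.fderiv_apply (𝕜 := ℝ) v).mul_right)
  have h2 : ∀ v, Integrable fun x => G x * fderiv ℝ F x v := fun v =>
    (hG.continuous.mul (hF'.clm_apply continuous_const)).integrable_of_hasCompactSupport
      hGc.mul_right
  have h3 : Integrable fun x => G x * F x :=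
    (hG.continuous.mul hF.continuous).integrable_of_hasCompactSupport hGc.mul_right
  have key : ∀ v, ∫ x, G x * fderiv ℝ F x v = - ∫ x, fderiv ℝ G x v * F x := fun v =>
    integral_mul_fderiv_eq_neg_fderiv_mul_of_integrable (h1 v) (h2 v) h3
      (fun x _ => hG.contDiffAt.differentiableAt (by simp))
      (fun x _ => hF.contDiffAt.differentiableAt (by simp))
  have e1 : ∀ x, G x * dbar i F x = G x * fderiv ℝ F x (Pi.single i 1) +
    I * (G x * fderiv ℝ F x (Pi.single i I)) := fun x => by simp only [dbar]; ring
  have e2 : ∀ x, dbar i G x * F x = fderiv ℝ G x (Pi.single i 1) * F x +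
    I * (fderiv ℝ G x (Pi.single i I) * F x) := fun x => by simp only [dbar]; ring
  simp only [e1, e2]
  rw [integral_add (h2 _) ((h2 _).const_mul _), integral_add (h1 _) ((h1 _).const_mul _),
    integral_const_mul, integral_const_mul, key, key]
  ring

/-- The regularised Cauchy-Fantappie formula. -/
lemma cauchy_fantappie {G : (Fin n → ℂ) → ℂ} (hG : ContDiff ℝ ∞ G) (hGc : HasCompactSupport G)
    (hs : ∀ k, ContDiff ℝ ∞ (s k)) (z : Fin n → ℂ) (ε : ℂ)
    (hx : ∀ x, ε - ∑ k, s k x * (z k - x k) ≠ 0) :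
    ∫ x, ∑ i, dbar i G x * (cofactorField s i x * (ε - ∑ k, s k x * (z k - x k))⁻¹ ^ n) =
      - (n * ε * ∫ x, G x * (dbarJac s x).det * (ε - ∑ k, s k x * (z k - x k))⁻¹ ^ (n + 1)) := by
  have hh : ContDiff ℝ ∞ fun y => ε - ∑ k, s k y * (z k - y k) := by fun_prop
  have hF : ∀ i, ContDiff ℝ ∞ fun y => cofactorField s i y *
      (ε - ∑ k, s k y * (z k - y k))⁻¹ ^ n := fun i =>
    (contDiff_cofactorField i hs).mul ((hh.inv hx).pow n)
  have hi : ∀ i, Integrable fun x => G x * dbar i (fun y => cofactorField s i y *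
      (ε - ∑ k, s k y * (z k - y k))⁻¹ ^ n) x := fun i =>
    (hG.continuous.mul ((hF i).dbar i).continuous).integrable_of_hasCompactSupport hGc.mul_right
  have hGi : ∀ i, HasCompactSupport (dbar i G) := fun i =>
    (hGc.fderiv_apply (𝕜 := ℝ) _).add ((hGc.fderiv_apply (𝕜 := ℝ) _).mul_left)
  have hi' : ∀ i, Integrable fun x => dbar i G x * (cofactorField s i x *
      (ε - ∑ k, s k x * (z k - x k))⁻¹ ^ n) := fun i =>
    ((hG.dbar i).continuous.mul (hF i).continuous).integrable_of_hasCompactSupport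
      (hGi i).mul_right
  rw [integral_finsetSum _ fun i _ => hi' i, ← integral_const_mul, ← integral_neg]
  have e : ∀ i, ∫ x, dbar i G x * (cofactorField s i x *
      (ε - ∑ k, s k x * (z k - x k))⁻¹ ^ n) = - ∫ x, G x * dbar i (fun y => cofactorField s i y *
      (ε - ∑ k, s k y * (z k - y k))⁻¹ ^ n) x := fun i => by
    rw [integral_mul_dbar hG hGc (hF i) i, neg_neg]
  simp only [e]
  rw [Finset.sum_neg_distrib, ← integral_finsetSum _ fun i _ => hi i, ← integral_neg]
  congr 1
  ext x
  rw [← Finset.mul_sum, sum_dbar_kernel hs z ε (hx x)]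
  ring

end dbar

section hull

variable {n : ℕ}

lemma continuous_eval_mvPolynomial (P : MvPolynomial (Fin n) ℂ) :
    Continuous fun z : Fin n → ℂ => MvPolynomial.eval z P := MvPolynomial.continuous_eval P

lemma bddAbove_norm_eval {K : Set (Fin n → ℂ)} (hK : IsCompact K) (P : MvPolynomial (Fin n) ℂ) :
    BddAbove ((fun w => ‖MvPolynomial.eval w P‖) '' K) :=
  hK.bddAbove_image (continuous_eval_mvPolynomial P).norm.continuousOn

lemma subset_polyHull {K : Set (Fin n → ℂ)} (hK : IsCompact K) : K ⊆ polyHull n K :=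
  fun z hz P => le_csSup (bddAbove_norm_eval hK P) ⟨z, hz, rfl⟩

lemma isCompact_polyHull {K : Set (Fin n → ℂ)} : IsCompact (polyHull n K) := by
  have hcl : IsClosed (polyHull n K) := by
    simp only [polyHull, Set.ofPred_forall]
    exact isClosed_iInter fun P =>
      isClosed_le (continuous_eval_mvPolynomial P).norm continuous_const
  refine (isCompact_univ_pi fun i : Fin n => isCompact_closedBall (0 : ℂ)
    (sSup ((fun w => ‖MvPolynomial.eval w (MvPolynomial.X i)‖) '' K))).of_isClosed_subset hcl ?_
  intro z hz i _
  simpa using hz (MvPolynomial.X i)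

lemma norm_eval_le_of_mem_polyHull {K : Set (Fin n → ℂ)} (hne : K.Nonempty) {z : Fin n → ℂ}
    (hz : z ∈ polyHull n K) {P : MvPolynomial (Fin n) ℂ} {M : ℝ}
    (hM : ∀ w ∈ K, ‖MvPolynomial.eval w P‖ ≤ M) : ‖MvPolynomial.eval z P‖ ≤ M := by
  refine (hz P).trans (csSup_le (hne.image _) ?_)
  rintro _ ⟨w, hw, rfl⟩
  exact hM w hw

lemma nonempty_of_mem_polyHull {K : Set (Fin n → ℂ)} {z : Fin n → ℂ} (hz : z ∈ polyHull n K) :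
    K.Nonempty := by
  rw [Set.nonempty_iff_ne_empty]
  rintro rfl
  have := hz 1
  norm_num at this

/-- A compact set off the polynomial hull is separated from it by the sum of squared moduli of
finitely many polynomials. -/
lemma exists_polynomials_separating {K : Set (Fin n → ℂ)} (hK : IsCompact K) (hne : K.Nonempty)
    {T : Set (Fin n → ℂ)} (hT : IsCompact T) (hd : Disjoint T (polyHull n K)) :
    ∀ ε > (0 : ℝ), ∃ (ι : Type) (_ : Fintype ι) (p : ι → MvPolynomial (Fin n) ℂ),
      (∀ z ∈ polyHull n K, ∑ j, ‖MvPolynomial.eval z (p j)‖ ^ 2 ≤ ε) ∧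
      ∀ x ∈ T, 2 < ∑ j, ‖MvPolynomial.eval x (p j)‖ ^ 2 := by
  refine hT.induction_on (p := fun T => ∀ ε > (0 : ℝ), ∃ (ι : Type) (_ : Fintype ι)
      (p : ι → MvPolynomial (Fin n) ℂ),
      (∀ z ∈ polyHull n K, ∑ j, ‖MvPolynomial.eval z (p j)‖ ^ 2 ≤ ε) ∧
      ∀ x ∈ T, 2 < ∑ j, ‖MvPolynomial.eval x (p j)‖ ^ 2) ?_ ?_ ?_ ?_
  · intro ε hε
    exact ⟨Empty, inferInstance, Empty.elim, by simp [hε.le], by simp⟩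
  · intro s t hst ht ε hε
    obtain ⟨ι, hι, p, h1, h2⟩ := ht ε hε
    exact ⟨ι, hι, p, h1, fun x hx => h2 x (hst hx)⟩
  · intro s t hs ht ε hε
    obtain ⟨ι, hι, p, h1, h2⟩ := hs (ε / 2) (by positivity)
    obtain ⟨κ, hκ, q, h3, h4⟩ := ht (ε / 2) (by positivity)
    refine ⟨ι ⊕ κ, inferInstance, Sum.elim p q, ?_, ?_⟩
    · intro z hz
      simp only [Fintype.sum_sum_type, Sum.elim_inl, Sum.elim_inr]
      linarith [h1 z hz, h3 z hz]
    · rintro x (hx | hx) <;> simp only [Fintype.sum_sum_type, Sum.elim_inl, Sum.elim_inr]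
      · have : 0 ≤ ∑ j, ‖MvPolynomial.eval x (q j)‖ ^ 2 := by positivity
        linarith [h2 x hx]
      · have : 0 ≤ ∑ j, ‖MvPolynomial.eval x (p j)‖ ^ 2 := by positivity
        linarith [h4 x hx]
  · intro x hx
    have hx' : x ∉ polyHull n K := Set.disjoint_left.1 hd hx
    simp only [polyHull, Set.mem_ofPred_eq, not_forall, not_le] at hx'
    obtain ⟨P, hP⟩ := hx'
    set m := sSup ((fun w => ‖MvPolynomial.eval w P‖) '' K)
    have hm : ∀ w ∈ polyHull n K, ‖MvPolynomial.eval w P‖ ≤ m := fun w hw => hw P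
    obtain ⟨m', hmm', hm'⟩ := exists_between hP
    have hm0 : 0 ≤ m := by
      obtain ⟨w, hw⟩ := hne
      exact (norm_nonneg _).trans (hm w (subset_polyHull hK hw))
    have hm'0 : 0 < m' := hm0.trans_lt hmm'
    refine ⟨{y | m' < ‖MvPolynomial.eval y P‖}, mem_nhdsWithin_of_mem_nhds
      ((isOpen_lt continuous_const (continuous_eval_mvPolynomial P).norm).mem_nhds hm'), ?_⟩
    intro ε hε
    obtain ⟨m'', h1, h2⟩ := exists_between hmm'
    have hm''0 : 0 < m'' := hm0.trans_lt h1
    have hr1 : (m / m'') ^ 2 < 1 := by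
      have : m / m'' < 1 := (div_lt_one hm''0).2 h1
      have : 0 ≤ m / m'' := by positivity
      nlinarith
    have hr2 : 1 < (m' / m'') ^ 2 := by
      have : 1 < m' / m'' := (one_lt_div hm''0).2 h2
      nlinarith
    obtain ⟨N, hN1, hN2⟩ := (((tendsto_pow_atTop_nhds_zero_of_lt_one (by positivity) hr1).eventually
      (gt_mem_nhds hε)).and ((tendsto_pow_atTop_atTop_of_one_lt hr2).eventually_gt_atTop 2)).exists
    have hev : ∀ y, ‖MvPolynomial.eval y ((MvPolynomial.C ((m'' : ℂ)⁻¹) * P) ^ N)‖ ^ 2 =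
        ((‖MvPolynomial.eval y P‖ / m'') ^ 2) ^ N := by
      intro y
      simp only [map_pow, map_mul, MvPolynomial.eval_C, norm_pow, norm_mul, norm_inv,
        Complex.norm_real, Real.norm_of_nonneg hm''0.le]
      rw [← pow_mul, mul_comm N 2, pow_mul, div_eq_inv_mul]
    refine ⟨Unit, inferInstance, fun _ => (MvPolynomial.C ((m'' : ℂ)⁻¹) * P) ^ N, ?_, ?_⟩
    · intro z hz
      simp only [Finset.univ_unique, Finset.sum_singleton, hev]
      refine le_trans ?_ hN1.le
      have := hm z hz
      gcongr
    · intro y hy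
      simp only [Finset.univ_unique, Finset.sum_singleton, hev]
      refine hN2.trans_le ?_
      have : m' < ‖MvPolynomial.eval y P‖ := hy
      gcongr

/-- The uniform closure of the polynomials in the continuous functions on `L`. -/
def polyClosure (L : Set (Fin n → ℂ)) [CompactSpace L] : Subalgebra ℂ C(L, ℂ) :=
  (MvPolynomial.aeval (R := ℂ) fun i : Fin n =>
    (⟨fun z : L => z.1 i, (continuous_apply i).comp continuous_subtype_val⟩ :
      C(L, ℂ))).range.topologicalClosure

variable {L : Set (Fin n → ℂ)}

lemma aeval_coord_apply (P : MvPolynomial (Fin n) ℂ) (z : L) :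
    MvPolynomial.aeval (R := ℂ) (fun i : Fin n =>
      (⟨fun z : L => z.1 i, (continuous_apply i).comp continuous_subtype_val⟩ : C(L, ℂ))) P z =
      MvPolynomial.eval z.1 P := by
  have h := MvPolynomial.comp_aeval_apply (R := ℂ) (fun i : Fin n =>
      (⟨fun z : L => z.1 i, (continuous_apply i).comp continuous_subtype_val⟩ : C(L, ℂ)))
      (ContinuousMap.evalAlgHom ℂ ℂ z) P
  exact h

variable [CompactSpace L]

lemma mem_polyClosure_of_eval {f : C(L, ℂ)} (P : MvPolynomial (Fin n) ℂ)
    (hf : ∀ z : L, f z = MvPolynomial.eval z.1 P) : f ∈ polyClosure L := by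
  refine Subalgebra.le_topologicalClosure _ ⟨P, ?_⟩
  ext z
  rw [hf z]
  exact aeval_coord_apply P z

lemma norm_apply_le_of_mem_polyClosure {K : Set (Fin n → ℂ)} (hne : K.Nonempty) (hKL : K ⊆ L)
    {f : C(L, ℂ)} (hf : f ∈ polyClosure L) {z : L} (hz : z.1 ∈ polyHull n K) {M : ℝ}
    (hM : ∀ w : L, w.1 ∈ K → ‖f w‖ ≤ M) : ‖f z‖ ≤ M := by
  refine le_of_forall_pos_le_add fun δ hδ => ?_
  obtain ⟨g, ⟨P, rfl⟩, hg⟩ := Metric.mem_closure_iff.1 hf (δ / 2) (by positivity)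
  have hd : ∀ w : L, ‖f w - MvPolynomial.eval w.1 P‖ ≤ δ / 2 := fun w => by
    rw [← aeval_coord_apply P w, ← dist_eq_norm]
    exact (ContinuousMap.dist_apply_le_dist w).trans hg.le
  have h1 : ‖MvPolynomial.eval z.1 P‖ ≤ M + δ / 2 := by
    refine norm_eval_le_of_mem_polyHull hne hz fun w hw => ?_
    have h2 := hd ⟨w, hKL hw⟩
    have h3 := hM ⟨w, hKL hw⟩ hw
    have h4 := norm_sub_norm_le (MvPolynomial.eval w P) (f ⟨w, hKL hw⟩)
    rw [norm_sub_rev] at h4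
    linarith
  have h5 := norm_sub_norm_le (f z) (MvPolynomial.eval z.1 P)
  linarith [hd z]

lemma exists_inv_sub_mem_polyClosure {u : C(L, ℂ)} (hu : u ∈ polyClosure L) {r : ℝ} (hr : 0 < r)
    (hur : ∀ z, ‖u z‖ < r) : ∃ g ∈ polyClosure L, ∀ z, g z = (r - u z)⁻¹ := by
  set v : C(L, ℂ) := ((r : ℂ)⁻¹) • u
  have hv : v ∈ polyClosure L := Subalgebra.smul_mem _ hu _
  have hv1 : ‖v‖ < 1 := by
    refine (ContinuousMap.norm_lt_iff _ one_pos).2 fun z => ?_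
    simp only [v, ContinuousMap.smul_apply, norm_smul, norm_inv, Complex.norm_real,
      Real.norm_of_nonneg hr.le]
    rw [inv_mul_lt_iff₀ hr, mul_one]
    exact hur z
  have hs := summable_geometric_of_norm_lt_one hv1
  have hS : ∑' k, v ^ k ∈ polyClosure L := by
    refine (Subalgebra.isClosed_topologicalClosure _).mem_of_tendsto
      hs.hasSum (Filter.Eventually.of_forall fun s => ?_)
    exact Subalgebra.sum_mem _ fun k _ => Subalgebra.pow_mem _ hv k
  refine ⟨((r : ℂ)⁻¹) • ∑' k, v ^ k, Subalgebra.smul_mem _ hS _, fun z => ?_⟩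
  have h1 := congrArg (fun f : C(L, ℂ) => f z) (mul_neg_geom_series v hv1)
  have hr' : (r : ℂ) ≠ 0 := by exact_mod_cast hr.ne'
  simp only [ContinuousMap.mul_apply, ContinuousMap.sub_apply, ContinuousMap.one_apply] at h1
  refine eq_inv_of_mul_eq_one_right ?_
  rw [ContinuousMap.smul_apply, smul_eq_mul, ← mul_assoc, ← h1]
  congr 1
  simp only [v, ContinuousMap.smul_apply, smul_eq_mul]
  field_simp

lemma exists_integral_mem_polyClosure {T : Set (Fin n → ℂ)} (hT : IsCompact T)
    {k : (Fin n → ℂ) → (Fin n → ℂ) → ℂ}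
    (hk : ContinuousOn (fun p : (Fin n → ℂ) × (Fin n → ℂ) => k p.1 p.2) (T ×ˢ L))
    (hmem : ∀ x ∈ T, ∃ g ∈ polyClosure L, ∀ z : L, g z = k x z) :
    ∃ F ∈ polyClosure L, ∀ z : L, F z = ∫ x in T, k x z := by
  have : CompactSpace T := isCompact_iff_compactSpace.1 hT
  let Φ : C(T, C(L, ℂ)) := ContinuousMap.curry
    ⟨fun p : T × L => k p.1 p.2, hk.comp_continuous (f := fun p : T × L => (p.1.1, p.2.1))
      (by fun_prop) fun p => ⟨p.1.2, p.2.2⟩⟩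
  have hΦ : ∀ x, Φ x ∈ polyClosure L := by
    intro x
    obtain ⟨g, hg, hgk⟩ := hmem x.1 x.2
    convert hg using 1
    ext z
    exact (hgk z).symm
  let μ : Measure T := volume.comap Subtype.val
  have : IsFiniteMeasure μ := ⟨by
    simp only [μ]
    rw [(MeasurableEmbedding.subtype_coe hT.measurableSet).comap_apply]
    simpa using hT.measure_lt_top⟩
  let A := Subalgebra.toSubmodule (polyClosure L)
  have hA : IsClosed (A : Set C(L, ℂ)) := Subalgebra.isClosed_topologicalClosure _
  have : CompleteSpace A := hA.completeSpace_coe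
  let Ψ : T → A := fun x => ⟨Φ x, hΦ x⟩
  have hΨ : Continuous Ψ := Φ.continuous.subtype_mk _
  have hΨi : Integrable Ψ μ := by
    have := hΨ.continuousOn.integrableOn_compact (μ := μ) isCompact_univ
    simpa using this
  refine ⟨(∫ x, Ψ x ∂μ : A), (∫ x, Ψ x ∂μ : A).2, fun z => ?_⟩
  have h := ((ContinuousMap.evalCLM ℂ z).comp A.subtypeL).integral_comp_comm hΨi
  refine h.symm.trans ?_
  rw [← integral_subtype_comap hT.measurableSet]
  rfl

end hull

section kernel

variable {n : ℕ}

/-- Functions of `(x, z)` which are smooth in `x` and polynomial in `z`: finite sums of products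
`β(x) R(z)` with `β` smooth and `R` a polynomial. -/
inductive PolyFamily : ((Fin n → ℂ) → (Fin n → ℂ) → ℂ) → Prop
  | smooth (β : (Fin n → ℂ) → ℂ) (hβ : ContDiff ℝ ∞ β) : PolyFamily fun x _ => β x
  | coord (k : Fin n) : PolyFamily fun _ z => z k
  | add {f g} (hf : PolyFamily f) (hg : PolyFamily g) : PolyFamily fun x z => f x z + g x z
  | mul {f g} (hf : PolyFamily f) (hg : PolyFamily g) : PolyFamily fun x z => f x z * g x z

namespace PolyFamily

variable {f : (Fin n → ℂ) → (Fin n → ℂ) → ℂ}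

lemma contDiff (hf : PolyFamily f) : ContDiff ℝ ∞ (Function.uncurry f) := by
  induction hf with
  | smooth β hβ => exact hβ.comp contDiff_fst
  | coord k => unfold Function.uncurry; fun_prop
  | add _ _ hf hg => exact hf.add hg
  | mul _ _ hf hg => exact hf.mul hg

lemma contDiff_left (hf : PolyFamily f) (z : Fin n → ℂ) : ContDiff ℝ ∞ fun x => f x z :=
  hf.contDiff.comp (contDiff_id.prodMk contDiff_const)

lemma exists_eval (hf : PolyFamily f) (x : Fin n → ℂ) :
    ∃ R : MvPolynomial (Fin n) ℂ, ∀ z, f x z = MvPolynomial.eval z R := by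
  induction hf with
  | smooth β hβ => exact ⟨MvPolynomial.C (β x), by simp⟩
  | coord k => exact ⟨MvPolynomial.X k, by simp⟩
  | add _ _ hf hg =>
    obtain ⟨R, hR⟩ := hf
    obtain ⟨S, hS⟩ := hg
    exact ⟨R + S, by simp [hR, hS]⟩
  | mul _ _ hf hg =>
    obtain ⟨R, hR⟩ := hf
    obtain ⟨S, hS⟩ := hg
    exact ⟨R * S, by simp [hR, hS]⟩

lemma dbar (hf : PolyFamily f) (i : Fin n) :
    PolyFamily fun x z => _root_.dbar i (fun y => f y z) x := by
  induction hf with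
  | smooth β hβ => exact smooth _ (hβ.dbar i)
  | coord k => simpa using smooth _ contDiff_const
  | add hf hg hf' hg' =>
    convert hf'.add hg' using 3 with x z
    exact dbar_add i ((hf.contDiff_left z).contDiffAt.differentiableAt (by simp))
      ((hg.contDiff_left z).contDiffAt.differentiableAt (by simp))
  | mul hf hg hf' hg' =>
    convert (hf'.mul hg).add (hf.mul hg') using 3 with x z
    exact dbar_mul i ((hf.contDiff_left z).contDiffAt.differentiableAt (by simp))
      ((hg.contDiff_left z).contDiffAt.differentiableAt (by simp))

lemma sum {ι : Type*} (t : Finset ι) {F : ι → (Fin n → ℂ) → (Fin n → ℂ) → ℂ}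
    (hF : ∀ k, PolyFamily (F k)) : PolyFamily fun x z => ∑ k ∈ t, F k x z := by
  classical
  induction t using Finset.induction_on with
  | empty => simpa using smooth _ contDiff_const
  | insert a t ha ih => simpa only [Finset.sum_insert ha] using (hF a).add ih

lemma prod {ι : Type*} (t : Finset ι) {F : ι → (Fin n → ℂ) → (Fin n → ℂ) → ℂ}
    (hF : ∀ k, PolyFamily (F k)) : PolyFamily fun x z => ∏ k ∈ t, F k x z := by
  classical
  induction t using Finset.induction_on with
  | empty => simpa using smooth _ contDiff_const
  | insert a t ha ih => simpa only [Finset.prod_insert ha] using (hF a).mul ih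

lemma det {m : ℕ} {M : (Fin n → ℂ) → (Fin n → ℂ) → Matrix (Fin m) (Fin m) ℂ}
    (hM : ∀ k l, PolyFamily fun x z => M x z k l) : PolyFamily fun x z => (M x z).det := by
  simp only [Matrix.det_apply']
  exact sum _ fun σ => (smooth _ contDiff_const).mul (prod _ fun k => hM _ _)

lemma cofactorField {s : Fin n → (Fin n → ℂ) → (Fin n → ℂ) → ℂ} (hs : ∀ k, PolyFamily (s k))
    (i : Fin n) : PolyFamily fun x z => _root_.cofactorField (fun k y => s k y z) i x := by
  refine det fun k l => ?_
  by_cases h : k = i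
  · subst h; simpa using hs l
  · simpa [h, dbarJac] using (hs l).dbar k

end PolyFamily

lemma contDiff_eval (P : MvPolynomial (Fin n) ℂ) :
    ContDiff ℂ ∞ fun z : Fin n → ℂ => MvPolynomial.eval z P := by
  induction P using MvPolynomial.induction_on with
  | C a => simpa using contDiff_const
  | add p q hp hq => simpa using hp.add hq
  | mul_X p i hp => simpa using hp.mul (contDiff_apply ℂ ℂ i)

/-- Hefer's decomposition of a polynomial. -/
lemma exists_hefer (P : MvPolynomial (Fin n) ℂ) :
    ∃ Q : Fin n → (Fin n → ℂ) → (Fin n → ℂ) → ℂ, (∀ k, PolyFamily (Q k)) ∧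
      ∀ x z, ∑ k, Q k x z * (z k - x k) = MvPolynomial.eval z P - MvPolynomial.eval x P := by
  induction P using MvPolynomial.induction_on with
  | C a => exact ⟨fun _ _ _ => 0, fun _ => .smooth _ contDiff_const, by simp⟩
  | add p q hp hq =>
    obtain ⟨Q, hQ, hQ'⟩ := hp
    obtain ⟨R, hR, hR'⟩ := hq
    refine ⟨fun k x z => Q k x z + R k x z, fun k => (hQ k).add (hR k), fun x z => ?_⟩
    simp only [add_mul, Finset.sum_add_distrib, hQ', hR', map_add]
    ring
  | mul_X p i hp =>
    obtain ⟨Q, hQ, hQ'⟩ := hp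
    refine ⟨fun k x z => Q k x z * z i + MvPolynomial.eval x p * (if k = i then 1 else 0),
      fun k => ((hQ k).mul (.coord i)).add (.mul
        (.smooth _ ((contDiff_eval p).restrict_scalars ℝ)) (.smooth _ contDiff_const)),
      fun x z => ?_⟩
    have h : ∀ k, (Q k x z * z i + MvPolynomial.eval x p * (if k = i then 1 else 0)) *
        (z k - x k) = z i * (Q k x z * (z k - x k)) +
          if k = i then MvPolynomial.eval x p * (z k - x k) else 0 := by
      intro k; split_ifs <;> ring
    simp only [h, Finset.sum_add_distrib, ← Finset.mul_sum, hQ', map_mul, MvPolynomial.eval_X,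
      Finset.sum_ite_eq', Finset.mem_univ, if_true]
    ring

lemma contDiff_cofactorField_uncurry {s : Fin n → (Fin n → ℂ) → (Fin n → ℂ) → ℂ}
    (hs : ∀ k, ContDiff ℝ ∞ (Function.uncurry (s k))) (i : Fin n) :
    ContDiff ℝ ∞ fun q : (Fin n → ℂ) × (Fin n → ℂ) =>
      cofactorField (fun k y => s k y q.2) i q.1 := by
  refine contDiff_det fun k l => ?_
  by_cases h : k = i
  · subst h; simpa [Function.uncurry_def] using hs l
  · simpa [h, dbarJac, Function.uncurry_def] using (hs l).dbar_param k

lemma contDiff_det_dbarJac_uncurry {s : Fin n → (Fin n → ℂ) → (Fin n → ℂ) → ℂ}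
    (hs : ∀ k, ContDiff ℝ ∞ (Function.uncurry (s k))) :
    ContDiff ℝ ∞ fun q : (Fin n → ℂ) × (Fin n → ℂ) =>
      (dbarJac (fun k y => s k y q.2) q.1).det :=
  contDiff_det fun k l => (hs l).dbar_param k

/-- A Leray section adapted to a polynomial hull `H`, with poles only on the diagonal: it agrees
with the Bochner-Martinelli section near the diagonal, and produces kernels which are uniform
limits of polynomials on `H` when the first variable lies in `T`. -/
structure LeraySection (H X T : Set (Fin n → ℂ)) [CompactSpace H] where
  /-- The components of the section. -/
  toFun : Fin n → (Fin n → ℂ) → (Fin n → ℂ) → ℂ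
  contDiff : ∀ k, ContDiff ℝ ∞ (Function.uncurry (toFun k))
  nonneg : ∀ x, ∀ z ∈ H, 0 ≤ (-∑ k, toFun k x z * (z k - x k)).re
  lower : ∃ c > 0, ∀ x ∈ X, ∀ z ∈ H, c * ‖x - z‖ ^ 2 ≤ (-∑ k, toFun k x z * (z k - x k)).re
  upper : ∃ C, ∀ x ∈ X, ∀ z ∈ H, ∀ k, ‖toFun k x z‖ ≤ C * ‖x - z‖
  eq_conj : ∀ z ∈ H, ∀ᶠ x in nhds z, ∀ k, toFun k x z = (starRingEnd ℂ) (x k - z k)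
  mem_polyClosure : ∀ x ∈ T, ∀ ε : ℝ, 0 < ε → ∀ i, ∃ g ∈ polyClosure H, ∀ z : H, g z =
    cofactorField (fun k y => toFun k y z) i x *
      (ε - ∑ k, toFun k x z * (z.1 k - x k))⁻¹ ^ n

lemma exists_leraySection {K : Set (Fin n → ℂ)} (hK : IsCompact K) (hne : K.Nonempty)
    [CompactSpace (polyHull n K)]
    {X T : Set (Fin n → ℂ)} (hX : IsCompact X) (hT : IsCompact T)
    (hd : Disjoint T (polyHull n K)) : Nonempty (LeraySection (polyHull n K) X T) := by
  obtain ⟨ι, _, p, hp1, hp2⟩ := exists_polynomials_separating hK hne hT hd (1 / 2) (by norm_num)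
  choose Q hQ hQ' using fun j => exists_hefer (p j)
  have hH : IsCompact (polyHull n K) := isCompact_polyHull
  set H := polyHull n K
  let φ : (Fin n → ℂ) → ℝ := fun x => ∑ j, ‖MvPolynomial.eval x (p j)‖ ^ 2
  have hpc : ∀ j, ContDiff ℝ ∞ fun x : Fin n → ℂ => MvPolynomial.eval x (p j) := fun j =>
    (contDiff_eval (p j)).restrict_scalars ℝ
  have hφ : ContDiff ℝ ∞ φ := ContDiff.sum fun j _ => (hpc j).norm_sq ℝ
  let θ : (Fin n → ℂ) → ℝ := fun x => Real.smoothTransition (2 - φ x)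
  have hθ : ContDiff ℝ ∞ θ := Real.smoothTransition.contDiff.comp (contDiff_const.sub hφ)
  have hθ0 : ∀ x, 0 ≤ θ x := fun x => Real.smoothTransition.nonneg _
  have hθ1 : ∀ x, θ x ≤ 1 := fun x => Real.smoothTransition.le_one _
  have hθφ1 : ∀ x, φ x ≤ 1 → θ x = 1 := fun x hx =>
    Real.smoothTransition.one_of_one_le (by linarith)
  have hθφ2 : ∀ x, 2 < φ x → θ x = 0 := fun x hx =>
    Real.smoothTransition.zero_of_nonpos (by linarith)
  have hθc : ContDiff ℝ ∞ fun x => (θ x : ℂ) := ofRealCLM.contDiff.comp hθ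
  let s₀ : Fin n → (Fin n → ℂ) → (Fin n → ℂ) → ℂ := fun k x z =>
    ∑ j, (starRingEnd ℂ) (MvPolynomial.eval x (p j)) * Q j k x z
  have hs₀ : ∀ k, PolyFamily (s₀ k) := fun k => .sum _ fun j =>
    .mul (.smooth _ (conjCLE.contDiff.comp (hpc j))) (hQ j k)
  let s : Fin n → (Fin n → ℂ) → (Fin n → ℂ) → ℂ := fun k x z =>
    θ x * (starRingEnd ℂ) (x k - z k) + (1 - θ x) * s₀ k x z
  have hs : ∀ k, ContDiff ℝ ∞ (Function.uncurry (s k)) := by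
    intro k
    have h1 : ContDiff ℝ ∞ fun q : (Fin n → ℂ) × (Fin n → ℂ) => (starRingEnd ℂ) (q.1 k - q.2 k) :=
      conjCLE.contDiff.comp (by fun_prop)
    have h2 : ContDiff ℝ ∞ fun q : (Fin n → ℂ) × (Fin n → ℂ) => (θ q.1 : ℂ) :=
      hθc.comp contDiff_fst
    exact (h2.mul h1).add ((contDiff_const.sub h2).mul (hs₀ k).contDiff)
  have hsum₀ : ∀ x z, ∑ k, s₀ k x z * (z k - x k) = ∑ j,
      (starRingEnd ℂ) (MvPolynomial.eval x (p j)) * MvPolynomial.eval z (p j) - φ x := by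
    intro x z
    have h1 : (φ x : ℂ) = ∑ j, (starRingEnd ℂ) (MvPolynomial.eval x (p j)) *
        MvPolynomial.eval x (p j) := by
      simp only [φ, ofReal_sum, ofReal_pow, ← Complex.conj_mul']
    rw [h1, ← Finset.sum_sub_distrib]
    simp only [← mul_sub, ← hQ', Finset.mul_sum, s₀, Finset.sum_mul]
    rw [Finset.sum_comm]
    simp only [mul_assoc]
  have hcross : ∀ x, ∀ z ∈ H, ‖∑ j, (starRingEnd ℂ) (MvPolynomial.eval x (p j)) *
      MvPolynomial.eval z (p j)‖ ≤ φ x / 2 + 1 / 4 := by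
    intro x z hz
    have h1 := hp1 z hz
    calc _ ≤ ∑ j, ‖(starRingEnd ℂ) (MvPolynomial.eval x (p j)) * MvPolynomial.eval z (p j)‖ :=
          norm_sum_le _ _
      _ ≤ ∑ j, (‖MvPolynomial.eval x (p j)‖ ^ 2 / 2 + ‖MvPolynomial.eval z (p j)‖ ^ 2 / 2) := by
          refine Finset.sum_le_sum fun j _ => ?_
          rw [norm_mul, RCLike.norm_conj]
          nlinarith [sq_nonneg (‖MvPolynomial.eval x (p j)‖ - ‖MvPolynomial.eval z (p j)‖)]
      _ ≤ φ x / 2 + 1 / 4 := by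
          rw [Finset.sum_add_distrib, ← Finset.sum_div, ← Finset.sum_div]
          simp only [φ]
          linarith
  have hre₀ : ∀ x, ∀ z ∈ H, φ x / 2 - 1 / 4 ≤ (-∑ k, s₀ k x z * (z k - x k)).re := by
    intro x z hz
    have h1 := (Complex.re_le_norm _).trans (hcross x z hz)
    rw [hsum₀, neg_re, sub_re, ofReal_re]
    linarith
  have hsum : ∀ x z, (-∑ k, s k x z * (z k - x k)).re =
      θ x * ∑ k, ‖x k - z k‖ ^ 2 + (1 - θ x) * (-∑ k, s₀ k x z * (z k - x k)).re := by
    intro x z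
    have h1 : -∑ k, s k x z * (z k - x k) = ((θ x : ℝ) : ℂ) * ((∑ k, ‖x k - z k‖ ^ 2 : ℝ) : ℂ) +
        ((1 - θ x : ℝ) : ℂ) * (-∑ k, s₀ k x z * (z k - x k)) := by
      simp only [ofReal_sum, ofReal_pow, ← Complex.conj_mul', Finset.mul_sum,
        ← Finset.sum_neg_distrib, ← Finset.sum_add_distrib, s]
      refine Finset.sum_congr rfl fun k _ => ?_
      push_cast
      ring
    rw [h1, add_re, re_ofReal_mul, re_ofReal_mul, ofReal_re]
  have hlow : ∀ x, ∀ z ∈ H, θ x * ∑ k, ‖x k - z k‖ ^ 2 + (1 - θ x) * (1 / 4) ≤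
      (-∑ k, s k x z * (z k - x k)).re := by
    intro x z hz
    rw [hsum]
    by_cases hx : φ x ≤ 1
    · simp [hθφ1 x hx]
    · have := hre₀ x z hz
      have : 1 / 4 ≤ (-∑ k, s₀ k x z * (z k - x k)).re := by linarith
      have := mul_le_mul_of_nonneg_left this (sub_nonneg.2 (hθ1 x))
      linarith
  have hnorm : ∀ x z : Fin n → ℂ, ‖x - z‖ ^ 2 ≤ ∑ k, ‖x k - z k‖ ^ 2 := by
    intro x z
    rw [← Real.le_sqrt (norm_nonneg _) (by positivity), pi_norm_le_iff_of_nonneg (by positivity)]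
    intro k
    refine Real.le_sqrt_of_sq_le ?_
    exact Finset.single_le_sum (f := fun k => ‖x k - z k‖ ^ 2) (fun _ _ => by positivity)
      (Finset.mem_univ k)
  refine ⟨⟨s, hs, ?_, ?_, ?_, ?_, ?_⟩⟩
  · intro x z hz
    refine le_trans ?_ (hlow x z hz)
    have := hθ0 x
    have := sub_nonneg.2 (hθ1 x)
    positivity
  · obtain ⟨R, hR⟩ := (hX.prod hH).bddAbove_image
      (f := fun q : (Fin n → ℂ) × (Fin n → ℂ) => ‖q.1 - q.2‖ ^ 2) (by fun_prop)
    have hR' : 0 < max R 1 := by positivity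
    refine ⟨1 / (4 * max R 1), by positivity, fun x hx z hz => ?_⟩
    have h1 : ‖x - z‖ ^ 2 ≤ max R 1 := (hR ⟨(x, z), ⟨hx, hz⟩, rfl⟩).trans (le_max_left _ _)
    have h2 : 1 / (4 * max R 1) * ‖x - z‖ ^ 2 ≤ 1 / 4 := by
      rw [one_div_mul_eq_div, div_le_iff₀ (by positivity)]; linarith
    have h3 : 1 / (4 * max R 1) * ‖x - z‖ ^ 2 ≤ ∑ k, ‖x k - z k‖ ^ 2 := by
      refine le_trans ?_ (hnorm x z)
      refine mul_le_of_le_one_left (by positivity) ?_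
      rw [div_le_one (by positivity)]
      linarith [le_max_right R 1]
    have h4 := mul_le_mul_of_nonneg_left h3 (hθ0 x)
    have h5 := mul_le_mul_of_nonneg_left h2 (sub_nonneg.2 (hθ1 x))
    linarith [hlow x z hz]
  · have hX1 : IsCompact (X ∩ {x | 1 ≤ φ x}) :=
      hX.inter_right (isClosed_le continuous_const hφ.continuous)
    obtain ⟨d, hd0, hd⟩ := (hX1.prod hH).exists_forall_le'
      (f := fun q : (Fin n → ℂ) × (Fin n → ℂ) => ‖q.1 - q.2‖) (a := 0) (by fun_prop) (by
        rintro ⟨x, z⟩ ⟨⟨_, hx⟩, hz⟩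
        simp only [norm_pos_iff, sub_ne_zero]
        rintro rfl
        have := hp1 x hz
        have hx' : 1 ≤ φ x := hx
        simp only [φ] at hx'
        linarith)
    have hM : ∀ k, ∃ M, ∀ x ∈ X, ∀ z ∈ H, ‖s₀ k x z‖ ≤ M := by
      intro k
      obtain ⟨M, hM⟩ := (hX.prod hH).exists_bound_of_continuousOn
        (hs₀ k).contDiff.continuous.continuousOn
      exact ⟨M, fun x hx z hz => hM (x, z) ⟨hx, hz⟩⟩
    choose M hM using hM
    refine ⟨1 + ∑ k, |M k| / d, fun x hx z hz k => ?_⟩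
    have h1 : ‖(θ x : ℂ) * (starRingEnd ℂ) (x k - z k)‖ ≤ ‖x - z‖ := by
      rw [norm_mul, RCLike.norm_conj, Complex.norm_real, Real.norm_of_nonneg (hθ0 x)]
      exact (mul_le_of_le_one_left (norm_nonneg _) (hθ1 x)).trans (norm_le_pi_norm (x - z) k)
    have h2 : ‖(1 - θ x : ℂ) * s₀ k x z‖ ≤ (|M k| / d) * ‖x - z‖ := by
      by_cases hx1 : φ x ≤ 1
      · rw [hθφ1 x hx1]; simp; positivity
      · have h3 := hd (x, z) ⟨⟨hx, (not_le.1 hx1).le⟩, hz⟩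
        have h4 : ‖(1 - θ x : ℂ)‖ ≤ 1 := by
          rw [← ofReal_one, ← ofReal_sub, Complex.norm_real,
            Real.norm_of_nonneg (sub_nonneg.2 (hθ1 x))]
          linarith [hθ0 x]
        have h5 : ‖s₀ k x z‖ ≤ |M k| := (hM k x hx z hz).trans (le_abs_self _)
        rw [norm_mul]
        calc _ ≤ 1 * |M k| := by gcongr
          _ = |M k| / d * d := by field_simp
          _ ≤ _ := by gcongr
    have h6 : |M k| / d ≤ ∑ k, |M k| / d :=
      Finset.single_le_sum (f := fun k => |M k| / d) (fun _ _ => by positivity) (Finset.mem_univ k)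
    calc ‖s k x z‖ ≤ ‖x - z‖ + (|M k| / d) * ‖x - z‖ := (norm_add_le _ _).trans (add_le_add h1 h2)
      _ ≤ ‖x - z‖ + (∑ k, |M k| / d) * ‖x - z‖ := by gcongr
      _ = _ := by ring
  · intro z hz
    have h1 : φ z < 1 := (hp1 z hz).trans_lt (by norm_num)
    filter_upwards [hφ.continuous.continuousAt.eventually_lt_const h1] with x hx k
    simp [s, hθφ1 x hx.le]
  · intro x hx ε hε i
    have hx2 : 2 < φ x := hp2 x hx
    have hev : ∀ᶠ y in nhds x, ∀ k z, s k y z = s₀ k y z := by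
      filter_upwards [hφ.continuous.continuousAt.eventually_const_lt hx2] with y hy k z
      simp [s, hθφ2 y hy]
    obtain ⟨P, hP⟩ := (PolyFamily.cofactorField hs₀ i).exists_eval x
    let U : MvPolynomial (Fin n) ℂ :=
      ∑ j, MvPolynomial.C ((starRingEnd ℂ) (MvPolynomial.eval x (p j))) * p j
    have hU : ∀ z, MvPolynomial.eval z U = ∑ j, (starRingEnd ℂ) (MvPolynomial.eval x (p j)) *
        MvPolynomial.eval z (p j) := fun z => by simp [U, map_sum]
    let u : C(H, ℂ) := ⟨fun z => MvPolynomial.eval z.1 U,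
      (continuous_eval_mvPolynomial U).comp continuous_subtype_val⟩
    let v : C(H, ℂ) := ⟨fun z => MvPolynomial.eval z.1 P,
      (continuous_eval_mvPolynomial P).comp continuous_subtype_val⟩
    have hu : u ∈ polyClosure H := mem_polyClosure_of_eval U fun _ => rfl
    have hv : v ∈ polyClosure H := mem_polyClosure_of_eval P fun _ => rfl
    obtain ⟨g, hg, hg'⟩ := exists_inv_sub_mem_polyClosure hu (r := ε + φ x) (by linarith) (by
      intro z
      refine lt_of_le_of_lt (?_ : _ ≤ φ x / 2 + 1 / 4) (by linarith)
      have := hcross x z.1 z.2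
      rwa [← hU] at this)
    refine ⟨v * g ^ n, Subalgebra.mul_mem _ hv (Subalgebra.pow_mem _ hg n), fun z => ?_⟩
    have hcof : cofactorField (fun k y => s k y z) i x = MvPolynomial.eval z.1 P := by
      rw [← hP]
      have hJ : dbarJac (fun k y => s k y z) x = dbarJac (fun k y => s₀ k y z) x := by
        ext a b
        exact dbar_congr a (hev.mono fun y hy => hy b z)
      have hrow : ∀ k, s k x z = s₀ k x z := fun k => hev.self_of_nhds k z
      simp only [cofactorField, hJ, hrow]
    have hden : (ε : ℂ) - ∑ k, s k x z * (z.1 k - x k) =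
        ((ε + φ x : ℝ) : ℂ) - u z := by
      have hrow : ∀ k, s k x z = s₀ k x z := fun k => hev.self_of_nhds k z
      simp only [hrow, hsum₀, u, ContinuousMap.coe_mk, hU]
      push_cast
      ring
    rw [hcof, hden, ContinuousMap.mul_apply, ContinuousMap.pow_apply, hg']
    rfl

end kernel

section estimates

variable {n : ℕ}

lemma finrank_pi_complex (n : ℕ) : Module.finrank ℝ (Fin n → ℂ) = 2 * n := by
  simp [Module.finrank_pi_fintype, mul_comm]

lemma integrable_indicator_ball_cauchy (hn : 1 ≤ n) (c R : ℝ) :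
    Integrable ((Metric.ball (0 : Fin n → ℂ) R).indicator
      fun w => ‖w‖ * (c * ‖w‖ ^ 2)⁻¹ ^ n) := by
  rw [integrable_indicator_iff measurableSet_ball]
  refine integrableOn_ball_of_norm_le_rpow (C := ‖(c⁻¹ ^ n)‖) (α := 2 * n - 1) ?_ ?_ ?_ ?_
  · rw [finrank_pi_complex]; omega
  · rw [finrank_pi_complex]; push_cast; linarith
  · refine ae_of_all _ fun w => ?_
    rcases eq_or_ne w 0 with rfl | hw
    · simp; positivity
    · have hw' : 0 < ‖w‖ := norm_pos_iff.2 hw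
      have h : ‖w‖ ^ (-(2 * (n : ℝ) - 1)) = ‖w‖ * (‖w‖ ^ 2)⁻¹ ^ n := by
        rw [neg_sub, Real.rpow_sub hw', Real.rpow_one, div_eq_mul_inv, inv_pow, ← pow_mul,
          ← Real.rpow_natCast]
        push_cast; rfl
      rw [h, mul_inv, mul_pow, norm_mul, norm_mul, norm_norm,
        Real.norm_of_nonneg (by positivity : 0 ≤ (‖w‖ ^ 2)⁻¹ ^ n)]
      exact le_of_eq (by ring)
  · refine Measurable.aestronglyMeasurable ?_
    fun_prop

lemma integrable_inv_one_add_norm_sq {c : ℝ} (hc : 0 < c) :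
    Integrable fun w : Fin n → ℂ => (1 + c * ‖w‖ ^ 2)⁻¹ ^ (n + 1) := by
  have h := integrable_rpow_neg_one_add_norm_sq (E := Fin n → ℂ) (μ := volume) (r := 2 * n + 2)
    (by rw [finrank_pi_complex]; push_cast; linarith)
  have h2 : ∀ w : Fin n → ℂ, (1 + ‖w‖ ^ 2) ^ (-(2 * (n : ℝ) + 2) / 2) =
      (1 + ‖w‖ ^ 2)⁻¹ ^ (n + 1) := fun w => by
    rw [show -(2 * (n : ℝ) + 2) / 2 = -((n + 1 : ℕ) : ℝ) by push_cast; ring,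
      Real.rpow_neg (by positivity), Real.rpow_natCast, inv_pow]
  simp only [h2] at h
  refine (h.comp_smul (R := √c) (by positivity)).congr (ae_of_all _ fun w => ?_)
  simp only [norm_smul, mul_pow, Real.norm_eq_abs, sq_abs, Real.sq_sqrt hc.le]

lemma inv_add_norm_sq_eq {c ε : ℝ} (hε : 0 < ε) (w : Fin n → ℂ) :
    (ε + c * ‖w‖ ^ 2)⁻¹ ^ (n + 1) =
      ε⁻¹ ^ (n + 1) * (1 + c * ‖(√ε)⁻¹ • w‖ ^ 2)⁻¹ ^ (n + 1) := by
  rw [← mul_pow, ← mul_inv, norm_smul, mul_pow ‖_‖, norm_inv, inv_pow ‖_‖, Real.norm_eq_abs,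
    sq_abs, Real.sq_sqrt hε.le]
  congr 2
  field_simp

lemma integrable_inv_add_norm_sq {c ε : ℝ} (hc : 0 < c) (hε : 0 < ε) :
    Integrable fun w : Fin n → ℂ => (ε + c * ‖w‖ ^ 2)⁻¹ ^ (n + 1) := by
  simp only [inv_add_norm_sq_eq hε]
  exact ((integrable_inv_one_add_norm_sq hc).comp_smul (by positivity)).const_mul _

lemma mul_integral_inv_add_norm_sq {c ε : ℝ} (hε : 0 < ε) :
    ε * ∫ w : Fin n → ℂ, (ε + c * ‖w‖ ^ 2)⁻¹ ^ (n + 1) =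
      ∫ w : Fin n → ℂ, (1 + c * ‖w‖ ^ 2)⁻¹ ^ (n + 1) := by
  simp only [inv_add_norm_sq_eq hε]
  rw [integral_const_mul, Measure.integral_comp_smul volume
    (fun w : Fin n → ℂ => (1 + c * ‖w‖ ^ 2)⁻¹ ^ (n + 1)), finrank_pi_complex, smul_eq_mul,
    abs_of_pos (by positivity), inv_pow √ε, inv_inv, pow_mul, Real.sq_sqrt hε.le,
    ← mul_assoc, ← mul_assoc, show ε * ε⁻¹ ^ (n + 1) * ε ^ n = 1 by rw [inv_pow, pow_succ]; field_simp, one_mul]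

namespace LeraySection

variable {H X T : Set (Fin n → ℂ)} [CompactSpace H] (S : LeraySection H X T)

/-- The section with fixed pole `z`. -/
def sec (z : Fin n → ℂ) (k : Fin n) (x : Fin n → ℂ) : ℂ := S.toFun k x z

/-- The regularised denominator of the Cauchy-Fantappie kernels. -/
def den (ε : ℝ) (z x : Fin n → ℂ) : ℂ := ε - ∑ k, S.sec z k x * (z k - x k)

lemma contDiff_sec (z : Fin n → ℂ) (k : Fin n) : ContDiff ℝ ∞ (S.sec z k) :=
  (S.contDiff k).comp (by fun_prop : ContDiff ℝ ∞ fun x : Fin n → ℂ => (x, z))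

lemma le_re_den (ε : ℝ) {z : Fin n → ℂ} (hz : z ∈ H) (x : Fin n → ℂ) :
    ε ≤ (S.den ε z x).re := by
  have := S.nonneg x z hz
  simp only [den, sec, sub_re, ofReal_re, neg_re] at this ⊢
  linarith

lemma den_ne_zero {ε : ℝ} (hε : 0 < ε) {z : Fin n → ℂ} (hz : z ∈ H) (x : Fin n → ℂ) :
    S.den ε z x ≠ 0 := fun h => by
  have := S.le_re_den ε hz x
  rw [h, zero_re] at this
  linarith

lemma continuous_den (ε : ℝ) :
    Continuous fun p : (Fin n → ℂ) × (Fin n → ℂ) => S.den ε p.2 p.1 := by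
  have h : ∀ k, Continuous fun p : (Fin n → ℂ) × (Fin n → ℂ) => S.sec p.2 k p.1 := fun k =>
    (S.contDiff k).continuous
  unfold den
  fun_prop

lemma exists_norm_inv_den_le : ∃ c > 0, ∀ ε > 0, ∀ x ∈ X, ∀ z ∈ H,
    ‖(S.den ε z x)⁻¹‖ ≤ (ε + c * ‖x - z‖ ^ 2)⁻¹ := by
  obtain ⟨c, hc, h⟩ := S.lower
  refine ⟨c, hc, fun ε hε x hx z hz => ?_⟩
  rw [norm_inv]
  refine inv_anti₀ (by positivity) (le_trans ?_ (re_le_norm _))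
  have := h x hx z hz
  simp only [den, sec, sub_re, ofReal_re, neg_re] at this ⊢
  linarith

lemma exists_norm_cofactorField_le (hX : IsCompact X) (hH : IsCompact H) :
    ∃ C ≥ 0, ∀ i, ∀ x ∈ X, ∀ z ∈ H, ‖cofactorField (S.sec z) i x‖ ≤ C * ‖x - z‖ := by
  obtain ⟨C, hC⟩ := S.upper
  have hJ : Continuous fun p : (Fin n → ℂ) × (Fin n → ℂ) =>
      (dbarJac (S.sec p.2) p.1).adjugate :=
    (continuous_matrix fun i k => ((S.contDiff k).dbar_param i).continuous).matrix_adjugate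
  have hb : ∀ k i, ∃ M, ∀ p ∈ X ×ˢ H, ‖(dbarJac (S.sec p.2) p.1).adjugate k i‖ ≤ M := fun k i =>
    (hX.prod hH).exists_bound_of_continuousOn (hJ.matrix_elem k i).continuousOn
  choose M hM using hb
  refine ⟨∑ i, ∑ k, |C| * |M k i|, by positivity, fun i x hx z hz => ?_⟩
  rw [cofactorField_eq_sum]
  calc ‖∑ k, S.sec z k x * (dbarJac (S.sec z) x).adjugate k i‖
      ≤ ∑ k, (|C| * ‖x - z‖) * |M k i| := by
        refine norm_sum_le_of_le _ fun k _ => ?_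
        rw [norm_mul]
        refine mul_le_mul ((hC x hx z hz k).trans ?_) ((hM k i (x, z) ⟨hx, hz⟩).trans
          (le_abs_self _)) (norm_nonneg _) (by positivity)
        exact mul_le_mul_of_nonneg_right (le_abs_self _) (norm_nonneg _)
    _ = (∑ k, |C| * |M k i|) * ‖x - z‖ := by
        rw [Finset.sum_mul]; exact Finset.sum_congr rfl fun k _ => by ring
    _ ≤ _ := by
        refine mul_le_mul_of_nonneg_right ?_ (norm_nonneg _)
        exact Finset.single_le_sum (f := fun i => ∑ k, |C| * |M k i|)
          (fun i _ => by positivity) (Finset.mem_univ i)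

lemma exists_norm_det_le (hX : IsCompact X) (hH : IsCompact H) :
    ∃ C ≥ 0, ∀ x ∈ X, ∀ z ∈ H, ‖(dbarJac (S.sec z) x).det‖ ≤ C := by
  obtain ⟨C, hC⟩ := (hX.prod hH).exists_bound_of_continuousOn
    (contDiff_det_dbarJac_uncurry S.contDiff).continuous.continuousOn
  exact ⟨|C|, abs_nonneg C, fun x hx z hz => (hC (x, z) ⟨hx, hz⟩).trans (le_abs_self C)⟩


lemma exists_norm_setIntegral_dbar_le (hn : 1 ≤ n) (hX : IsCompact X) (hH : IsCompact H)
    {χ : (Fin n → ℂ) → ℂ} (hχ : ContDiff ℝ ∞ χ) (hχX : tsupport χ ⊆ X) :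
    ∃ C ≥ 0, ∀ (Y : Set (Fin n → ℂ)) (g : (Fin n → ℂ) → ℂ), MeasurableSet Y → ∀ q ≥ 0,
      (∀ x ∈ Y, ∀ i, dbar i χ x ≠ 0 → ‖g x‖ ≤ q) → ∀ ε > 0, ∀ z ∈ H,
      ‖∫ x in Y, ∑ i, dbar i χ x * g x *
        (cofactorField (S.sec z) i x * (S.den ε z x)⁻¹ ^ n)‖ ≤ C * q := by
  obtain ⟨c, hc, hden⟩ := S.exists_norm_inv_den_le
  obtain ⟨C, hC0, hC⟩ := S.exists_norm_cofactorField_le hX hH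
  choose M hM using fun i => hX.exists_bound_of_continuousOn (hχ.dbar i).continuous.continuousOn
  obtain ⟨R, hR⟩ := ((hX.prod hH).image
    (continuous_fst.sub continuous_snd)).isBounded.subset_ball 0
  set F : (Fin n → ℂ) → ℝ := (Metric.ball (0 : Fin n → ℂ) R).indicator
    fun w => ‖w‖ * (c * ‖w‖ ^ 2)⁻¹ ^ n with hF
  have hFi : Integrable F := integrable_indicator_ball_cauchy hn c R
  have hF0 : ∀ w, 0 ≤ F w := fun w => Set.indicator_nonneg (fun w _ => by positivity) w
  refine ⟨(∑ i, |M i|) * C * ∫ w, F w, by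
      have := integral_nonneg (μ := volume) (f := F) (fun w => hF0 w)
      positivity,
    fun Y g hY q hq hg ε hε z hz => ?_⟩
  have hi : Integrable fun x => (∑ i, |M i|) * C * q * F (x - z) :=
    (hFi.comp_sub_right z).const_mul _
  calc _ ≤ ∫ x in Y, (∑ i, |M i|) * C * q * F (x - z) := by
        refine norm_integral_le_of_norm_le hi.integrableOn
          ((ae_restrict_iff' hY).2 (ae_of_all _ fun x hxY => ?_))
        by_cases hx : x ∈ X
        · have hker : ∀ i, ‖cofactorField (S.sec z) i x * (S.den ε z x)⁻¹ ^ n‖ ≤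
              C * F (x - z) := fun i => by
            have h1 := hC i x hx z hz
            have hb : x - z ∈ Metric.ball (0 : Fin n → ℂ) R := hR ⟨(x, z), ⟨hx, hz⟩, rfl⟩
            rw [norm_mul, norm_pow, hF, Set.indicator_of_mem hb, ← mul_assoc]
            rcases eq_or_ne x z with rfl | hxz
            · have : ‖cofactorField (S.sec x) i x‖ = 0 := by
                simpa using h1
              simp [this]
            · have hp : 0 < ‖x - z‖ := norm_pos_iff.2 (sub_ne_zero.2 hxz)
              refine mul_le_mul h1 (pow_le_pow_left₀ (norm_nonneg _)
                ((hden ε hε x hx z hz).trans (inv_anti₀ (by positivity) (by linarith))) _)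
                (by positivity) (by positivity)
          rw [Finset.sum_mul, Finset.sum_mul, Finset.sum_mul]
          refine norm_sum_le_of_le _ fun i _ => ?_
          by_cases hd : dbar i χ x = 0
          · rw [hd, zero_mul, zero_mul, norm_zero]
            have := hF0 (x - z)
            positivity
          · rw [norm_mul, norm_mul]
            calc _ ≤ |M i| * q * (C * F (x - z)) :=
                  mul_le_mul (mul_le_mul ((hM i x hx).trans (le_abs_self _)) (hg x hxY i hd)
                    (norm_nonneg _) (abs_nonneg _)) (hker i) (norm_nonneg _) (by positivity)
              _ = _ := by ring
        · have hd : ∀ i, dbar i χ x = 0 := fun i =>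
            dbar_eq_zero_of_notMem_tsupport i fun h => hx (hχX h)
          simp only [hd, zero_mul, Finset.sum_const_zero, norm_zero]
          have := hF0 (x - z)
          positivity
    _ ≤ ∫ x, (∑ i, |M i|) * C * q * F (x - z) :=
        setIntegral_le_integral hi (ae_of_all _ fun x => by
          have := hF0 (x - z)
          simp only [Pi.zero_apply]
          positivity)
    _ = _ := by
        rw [integral_const_mul, integral_sub_right_eq_self]
        ring

/-- The integral term of the Cauchy-Fantappie formula, up to the factor `-n`. -/
def solid (G : (Fin n → ℂ) → ℂ) (ε : ℝ) (z : Fin n → ℂ) : ℂ :=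
  ε * ∫ x, G x * (dbarJac (S.sec z) x).det * (S.den ε z x)⁻¹ ^ (n + 1)

lemma norm_inv_den_pow_le {c ε : ℝ} {x z : Fin n → ℂ} (hc : 0 < c) (hε : 0 < ε)
    (h : ‖(S.den ε z x)⁻¹‖ ≤ (ε + c * ‖x - z‖ ^ 2)⁻¹) {r : ℝ} (hr : 0 < r) (hxz : r ≤ ‖x - z‖) :
    ‖(S.den ε z x)⁻¹ ^ (n + 1)‖ ≤ (c * r ^ 2)⁻¹ ^ (n + 1) := by
  rw [norm_pow]
  refine pow_le_pow_left₀ (norm_nonneg _) (h.trans (inv_anti₀ (by positivity) ?_)) _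
  have : c * r ^ 2 ≤ c * ‖x - z‖ ^ 2 := by gcongr
  linarith

lemma exists_norm_solid_le (hX : IsCompact X) (hH : IsCompact H) :
    ∃ C ≥ 0, ∀ r > 0, ∃ C' ≥ 0, ∀ (G : (Fin n → ℂ) → ℂ) (q M : ℝ), 0 ≤ q → 0 ≤ M →
      (∀ x ∉ X, G x = 0) → (∀ x, ‖G x‖ ≤ M) → ∀ z ∈ H,
      (∀ x, ‖x - z‖ < r → ‖G x‖ ≤ q) → ∀ ε > 0, ‖S.solid G ε z‖ ≤ C * q + ε * (C' * M) := by
  obtain ⟨c, hc, hden⟩ := S.exists_norm_inv_den_le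
  obtain ⟨D, hD0, hD⟩ := S.exists_norm_det_le hX hH
  refine ⟨D * ∫ w : Fin n → ℂ, (1 + c * ‖w‖ ^ 2)⁻¹ ^ (n + 1),
    mul_nonneg hD0 (integral_nonneg fun w => by simp only [Pi.zero_apply]; positivity),
    fun r hr => ⟨D * (c * r ^ 2)⁻¹ ^ (n + 1) * volume.real X, by positivity, ?_⟩⟩
  intro G q M hq hM hGX hGM z hz hGq ε hε
  set u : (Fin n → ℂ) → ℝ := fun w => (ε + c * ‖w‖ ^ 2)⁻¹ ^ (n + 1) with hu
  have hu0 : ∀ w, 0 ≤ u w := fun w => by positivity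
  have hui : Integrable u := integrable_inv_add_norm_sq hc hε
  have hi1 : Integrable fun x => q * D * u (x - z) := (hui.comp_sub_right z).const_mul _
  have hi2 : Integrable (X.indicator fun _ : Fin n → ℂ => M * D * (c * r ^ 2)⁻¹ ^ (n + 1)) :=
    (integrable_indicator_iff hX.measurableSet).2 (integrableOn_const hX.measure_lt_top.ne)
  have hmain : ‖∫ x, G x * (dbarJac (S.sec z) x).det * (S.den ε z x)⁻¹ ^ (n + 1)‖ ≤
      ∫ x, (q * D * u (x - z) + X.indicator (fun _ => M * D * (c * r ^ 2)⁻¹ ^ (n + 1)) x) := by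
    refine norm_integral_le_of_norm_le (hi1.add hi2) (ae_of_all _ fun x => ?_)
    by_cases hx : x ∈ X
    · rw [Set.indicator_of_mem hx, norm_mul, norm_mul]
      rcases lt_or_ge ‖x - z‖ r with h | h
      · have h1 : ‖G x‖ * ‖(dbarJac (S.sec z) x).det‖ * ‖(S.den ε z x)⁻¹ ^ (n + 1)‖ ≤
            q * D * u (x - z) := by
          rw [norm_pow]
          exact mul_le_mul (mul_le_mul (hGq x h) (hD x hx z hz) (norm_nonneg _) hq)
            (pow_le_pow_left₀ (norm_nonneg _) (hden ε hε x hx z hz) _) (by positivity)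
            (by positivity)
        have h2 : 0 ≤ M * D * (c * r ^ 2)⁻¹ ^ (n + 1) := by positivity
        linarith
      · have h1 : ‖G x‖ * ‖(dbarJac (S.sec z) x).det‖ * ‖(S.den ε z x)⁻¹ ^ (n + 1)‖ ≤
            M * D * (c * r ^ 2)⁻¹ ^ (n + 1) :=
          mul_le_mul (mul_le_mul (hGM x) (hD x hx z hz) (norm_nonneg _) hM)
            (S.norm_inv_den_pow_le hc hε (hden ε hε x hx z hz) hr h) (norm_nonneg _)
            (by positivity)
        have h2 : 0 ≤ q * D * u (x - z) := by have := hu0 (x - z); positivity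
        linarith
    · rw [hGX x hx, Set.indicator_of_notMem hx]
      have := hu0 (x - z)
      simp only [zero_mul, norm_zero, add_zero]
      positivity
  rw [integral_add hi1 hi2, integral_const_mul, integral_sub_right_eq_self u,
    integral_indicator hX.measurableSet, setIntegral_const, smul_eq_mul] at hmain
  rw [solid, norm_mul, Complex.norm_real, Real.norm_of_nonneg hε.le,
    ← mul_integral_inv_add_norm_sq hε]
  calc _ ≤ _ := mul_le_mul_of_nonneg_left hmain hε.le
    _ = _ := by ring

lemma exists_le_norm_solid (hn : 1 ≤ n) (hX : IsCompact X) (hH : IsCompact H) :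
    ∃ a > 0, ∀ z ∈ H, ∀ ρ > 0,
      (∀ x, ‖x - z‖ < ρ → ∀ k, S.sec z k x = (starRingEnd ℂ) (x k - z k)) → ∃ C',
      ∀ (G : (Fin n → ℂ) → ℂ) (M : ℝ), Continuous G → 0 ≤ M → (∀ x ∉ X, G x = 0) →
      (∀ x, ‖G x‖ ≤ M) → (∀ x, ‖x - z‖ < ρ → 1 / 2 ≤ (G x).re) → ∀ ε > 0, √ε < ρ →
      a - ε * (C' * M) ≤ ‖S.solid G ε z‖ := by
  obtain ⟨c, hc, hden⟩ := S.exists_norm_inv_den_le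
  obtain ⟨D, hD0, hD⟩ := S.exists_norm_det_le hX hH
  have : Nonempty (Fin n) := ⟨⟨0, hn⟩⟩
  set v := volume.real (Metric.ball (0 : Fin n → ℂ) 1)
  have hv : 0 < v := ENNReal.toReal_pos (Metric.measure_ball_pos _ _ one_pos).ne'
    measure_ball_lt_top.ne
  refine ⟨1 / 2 * 2 ^ n * (1 + n : ℝ)⁻¹ ^ (n + 1) * v, by positivity, fun z hz ρ hρ hconj =>
    ⟨D * (c * ρ ^ 2)⁻¹ ^ (n + 1) * volume.real X, ?_⟩⟩
  intro G M hGc hM hGX hGM hGre ε hε hερ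
  set f : (Fin n → ℂ) → ℂ := fun x =>
    G x * (dbarJac (S.sec z) x).det * (S.den ε z x)⁻¹ ^ (n + 1) with hf
  have hdetc : Continuous fun x => (dbarJac (S.sec z) x).det :=
    (contDiff_det_dbarJac_uncurry S.contDiff).continuous.comp (Continuous.prodMk_left z)
  have hdenc : Continuous fun x => S.den ε z x :=
    (S.continuous_den ε).comp (Continuous.prodMk_left z)
  have hfc : Continuous f :=
    (hGc.mul hdetc).mul ((hdenc.inv₀ fun x => S.den_ne_zero hε hz x).pow _)
  have hfi : Integrable f := hfc.integrable_of_hasCompactSupport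
    (HasCompactSupport.intro hX fun x hx => by simp [hf, hGX x hx])
  have hlow : ∀ x ∈ Metric.ball z ρ, ∃ d : ℝ, ε + n * ‖x - z‖ ^ 2 ≥ d ∧ 0 < d ∧
      f x = G x * ((2 ^ n * d⁻¹ ^ (n + 1) : ℝ) : ℂ) := by
    intro x hx
    rw [mem_ball_iff_norm] at hx
    refine ⟨ε + ∑ k, ‖x k - z k‖ ^ 2, ?_, by positivity, ?_⟩
    · have : ∑ k, ‖x k - z k‖ ^ 2 ≤ ∑ _k : Fin n, ‖x - z‖ ^ 2 :=
        Finset.sum_le_sum fun k _ => pow_le_pow_left₀ (norm_nonneg _) (norm_le_pi_norm (x - z) k) 2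
      simp only [Finset.sum_const, Finset.card_univ, Fintype.card_fin, nsmul_eq_mul] at this
      linarith
    · have hJ : dbarJac (S.sec z) x = (2 : ℂ) • (1 : Matrix (Fin n) (Fin n) ℂ) := by
        ext i k
        have h1 : S.sec z k =ᶠ[nhds x] fun y => (starRingEnd ℂ) (y k) + (-(starRingEnd ℂ) (z k)) := by
          filter_upwards [(isOpen_lt (by fun_prop : Continuous fun y : Fin n → ℂ => ‖y - z‖)
            continuous_const).mem_nhds hx] with y hy
          rw [hconj y hy k, map_sub, sub_eq_add_neg]
        have h2 : DifferentiableAt ℝ (fun y : Fin n → ℂ => (starRingEnd ℂ) (y k)) x :=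
          (conjCLE.contDiff (n := 1).comp (by fun_prop : ContDiff ℝ 1 fun y : Fin n → ℂ => y k)).contDiffAt
            |>.differentiableAt (by simp)
        rw [dbarJac, Matrix.of_apply, dbar_congr i h1, dbar_add i h2 (differentiableAt_const _),
          dbar_conj_coord, dbar_const]
        simp [Matrix.one_apply]
      have hd : S.den ε z x = ((ε + ∑ k, ‖x k - z k‖ ^ 2 : ℝ) : ℂ) := by
        simp only [den, hconj x hx]
        push_cast
        rw [sub_eq_add_neg, ← Finset.sum_neg_distrib]
        congr 1
        refine Finset.sum_congr rfl fun k _ => ?_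
        rw [← Complex.conj_mul']
        ring
      simp only [hf]
      rw [hJ, hd, Matrix.det_smul, Matrix.det_one]
      push_cast
      simp
      ring
  have hre : 1 / 2 * 2 ^ n * ((1 + n) * ε : ℝ)⁻¹ ^ (n + 1) * (ε ^ n * v) ≤
      (∫ x in Metric.ball z ρ, f x).re := by
    have hpos : ∀ x ∈ Metric.ball z ρ, 0 ≤ (f x).re := fun x hx => by
      obtain ⟨d, -, hd, h⟩ := hlow x hx
      rw [h, re_mul_ofReal]
      have := hGre x (mem_ball_iff_norm.1 hx)
      positivity
    have hvol : volume.real (Metric.ball z √ε) = ε ^ n * v := by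
      rw [Measure.real, Measure.addHaar_ball volume z (Real.sqrt_nonneg ε), ENNReal.toReal_mul,
        finrank_pi_complex, ENNReal.toReal_ofReal (by positivity), pow_mul, Real.sq_sqrt hε.le]
      rfl
    have hsub : Metric.ball z √ε ⊆ Metric.ball z ρ := Metric.ball_subset_ball hερ.le
    have e : (∫ x in Metric.ball z ρ, f x).re = ∫ x in Metric.ball z ρ, (f x).re :=
      (integral_re (𝕜 := ℂ) hfi.integrableOn).symm
    rw [e]
    calc _ = ∫ _ in Metric.ball z √ε, 1 / 2 * 2 ^ n * ((1 + n) * ε : ℝ)⁻¹ ^ (n + 1) := by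
          rw [setIntegral_const, hvol, smul_eq_mul, mul_comm]
      _ ≤ ∫ x in Metric.ball z √ε, (f x).re := by
          refine setIntegral_mono_on (integrableOn_const measure_ball_lt_top.ne)
            hfi.re.integrableOn measurableSet_ball fun x hx => ?_
          obtain ⟨d, hd1, hd, h⟩ := hlow x (hsub hx)
          have hG := hGre x (mem_ball_iff_norm.1 (hsub hx))
          rw [mem_ball_iff_norm] at hx
          have h3 : ‖x - z‖ ^ 2 ≤ ε := by
            rw [← Real.sq_sqrt hε.le]
            exact pow_le_pow_left₀ (norm_nonneg _) hx.le 2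
          have h4 : d ≤ (1 + n) * ε := by nlinarith [(Nat.cast_nonneg n : (0 : ℝ) ≤ n)]
          rw [h, re_mul_ofReal, mul_assoc]
          gcongr
      _ ≤ ∫ x in Metric.ball z ρ, (f x).re :=
          setIntegral_mono_set hfi.re.integrableOn
            ((ae_restrict_iff' measurableSet_ball).2 (ae_of_all _ hpos)) hsub.eventuallyLE
  have hout : ‖∫ x in (Metric.ball z ρ)ᶜ, f x‖ ≤
      M * D * (c * ρ ^ 2)⁻¹ ^ (n + 1) * volume.real X := by
    have hi2 : Integrable (X.indicator fun _ : Fin n → ℂ => M * D * (c * ρ ^ 2)⁻¹ ^ (n + 1)) :=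
      (integrable_indicator_iff hX.measurableSet).2 (integrableOn_const hX.measure_lt_top.ne)
    calc _ ≤ ∫ x in (Metric.ball z ρ)ᶜ, X.indicator (fun _ => M * D * (c * ρ ^ 2)⁻¹ ^ (n + 1)) x := by
          refine norm_integral_le_of_norm_le hi2.integrableOn
            ((ae_restrict_iff' measurableSet_ball.compl).2 (ae_of_all _ fun x hxb => ?_))
          rw [Set.mem_compl_iff, mem_ball_iff_norm, not_lt] at hxb
          by_cases hx : x ∈ X
          · rw [Set.indicator_of_mem hx, hf, norm_mul, norm_mul]
            exact mul_le_mul (mul_le_mul (hGM x) (hD x hx z hz) (norm_nonneg _) hM)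
              (S.norm_inv_den_pow_le hc hε (hden ε hε x hx z hz) hρ hxb) (norm_nonneg _)
              (by positivity)
          · simp [hf, hGX x hx, Set.indicator_of_notMem hx]
      _ ≤ ∫ x, X.indicator (fun _ => M * D * (c * ρ ^ 2)⁻¹ ^ (n + 1)) x :=
          setIntegral_le_integral hi2 (ae_of_all _ fun x =>
            Set.indicator_nonneg (fun _ _ => by positivity) x)
      _ = _ := by
          rw [integral_indicator hX.measurableSet, setIntegral_const, smul_eq_mul, mul_comm]
  rw [solid, norm_mul, Complex.norm_real, Real.norm_of_nonneg hε.le,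
    ← integral_add_compl measurableSet_ball hfi]
  have h1 : (1 / 2 * 2 ^ n * ((1 + n) * ε : ℝ)⁻¹ ^ (n + 1) * (ε ^ n * v)) -
      M * D * (c * ρ ^ 2)⁻¹ ^ (n + 1) * volume.real X ≤
      ‖(∫ x in Metric.ball z ρ, f x) + ∫ x in (Metric.ball z ρ)ᶜ, f x‖ := by
    have h2 := norm_sub_norm_le (∫ x in Metric.ball z ρ, f x) (-∫ x in (Metric.ball z ρ)ᶜ, f x)
    rw [norm_neg, sub_neg_eq_add] at h2
    have h3 := re_le_norm (∫ x in Metric.ball z ρ, f x)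
    linarith
  refine le_trans (le_of_eq ?_) (mul_le_mul_of_nonneg_left h1 hε.le)
  have h5 : ε * (ε⁻¹ ^ (n + 1) * ε ^ n) = 1 := by rw [inv_pow, pow_succ]; field_simp
  rw [mul_inv (1 + n : ℝ) ε, mul_pow _ ε⁻¹]
  linear_combination (-(1 / 2 * 2 ^ n * (1 + n : ℝ)⁻¹ ^ (n + 1) * v)) * h5

end LeraySection

end estimates

section trace

variable {n : ℕ}

set_option maxHeartbeats 400000 in
open Filter Topology in
lemma exists_one_le_mul_of_leraySection (hn : 1 ≤ n) {K X T W : Set (Fin n → ℂ)}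
    (hK : IsCompact K) [CompactSpace (polyHull n K)] (hX : IsCompact X) (hT : IsCompact T)
    (hW : IsOpen W) (S : LeraySection (polyHull n K) X T) {χ : (Fin n → ℂ) → ℂ}
    (hχ : ContDiff ℝ ∞ χ) (hχX : tsupport χ ⊆ X) (hχ1 : ∀ x, ‖χ x‖ ≤ 1)
    (hχT : ∀ x ∉ T, ∀ i, dbar i χ x ≠ 0 → x ∈ W) (hKW : ∀ x ∈ K, x ∈ tsupport χ → x ∈ W)
    {z₀ : Fin n → ℂ} (hz₀ : z₀ ∈ polyHull n K) (hχz : ∀ᶠ x in 𝓝 z₀, χ x = 1) :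
    ∃ C : ℝ, ∀ (P : MvPolynomial (Fin n) ℂ) (q : ℝ), 0 ≤ q →
      (∀ x ∈ W, ‖MvPolynomial.eval x P‖ ≤ q) → MvPolynomial.eval z₀ P = 1 → 1 ≤ C * q := by
  have hH : IsCompact (polyHull n K) := isCompact_polyHull
  obtain ⟨A, -, hA⟩ := S.exists_norm_setIntegral_dbar_le hn hX hH hχ hχX
  obtain ⟨L, -, hL⟩ := S.exists_norm_solid_le hX hH
  obtain ⟨a, ha, hlow⟩ := S.exists_le_norm_solid hn hX hH
  obtain ⟨r, hr, hrW⟩ := hK.exists_thickening_subset_open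
    (hW.union (isClosed_tsupport χ).isOpen_compl)
    (fun x hx => (em (x ∈ tsupport χ)).imp (hKW x hx) id)
  obtain ⟨L', -, hL'⟩ := hL r hr
  have hn' : (0 : ℝ) < n := by exact_mod_cast hn
  refine ⟨(n * L + 2 * A) / (n * a), fun P q hq hPW hP1 => ?_⟩
  have hPd : ContDiff ℂ ∞ fun x : Fin n → ℂ => MvPolynomial.eval x P := contDiff_eval P
  have hPc : Continuous fun x : Fin n → ℂ => MvPolynomial.eval x P := hPd.continuous
  set G : (Fin n → ℂ) → ℂ := fun x => χ x * MvPolynomial.eval x P with hG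
  have hGs : ContDiff ℝ ∞ G := hχ.mul (hPd.restrict_scalars ℝ)
  have hGX : ∀ x ∉ X, G x = 0 := fun x hx => by
    simp [hG, image_eq_zero_of_notMem_tsupport fun h => hx (hχX h)]
  have hGc : HasCompactSupport G := HasCompactSupport.intro hX hGX
  have hGP : ∀ x, ‖G x‖ ≤ ‖MvPolynomial.eval x P‖ := fun x => by
    rw [hG, norm_mul]
    exact mul_le_of_le_one_left (norm_nonneg _) (hχ1 x)
  have hdG : ∀ i x, dbar i G x = dbar i χ x * MvPolynomial.eval x P := fun i x => by
    have h1 : DifferentiableAt ℂ (fun x : Fin n → ℂ => MvPolynomial.eval x P) x :=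
      hPd.contDiffAt.differentiableAt (by simp)
    rw [hG, dbar_mul i (hχ.contDiffAt.differentiableAt (by simp)) (h1.restrictScalars ℝ),
      dbar_eq_zero i h1, mul_zero, add_zero]
  obtain ⟨M, hM⟩ := hGc.exists_bound_of_continuous hGs.continuous
  have hM0 : 0 ≤ M := (norm_nonneg _).trans (hM 0)
  have hGq : ∀ z ∈ K, ∀ x, ‖x - z‖ < r → ‖G x‖ ≤ q := fun z hz x hx => by
    rcases hrW (Metric.mem_thickening_iff.2 ⟨z, hz, by rwa [dist_eq_norm]⟩) with h | h
    · exact (hGP x).trans (hPW x h)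
    · simp [hG, image_eq_zero_of_notMem_tsupport h, hq]
  have hre : ∀ᶠ x in 𝓝 z₀, 1 / 2 ≤ (MvPolynomial.eval x P).re :=
    (continuous_re.comp hPc).continuousAt.eventually_const_le (by simp [hP1]; norm_num)
  obtain ⟨ρ, hρ, hρ'⟩ := Metric.eventually_nhds_iff.1 ((S.eq_conj z₀ hz₀).and (hχz.and hre))
  simp only [dist_eq_norm] at hρ'
  obtain ⟨B, hB⟩ := hlow z₀ hz₀ ρ hρ fun x hx => (hρ' hx).1
  have key : ∀ ε > 0, √ε < ρ →
      n * (a - ε * (B * M)) ≤ n * (L * q + ε * (L' * M)) + 2 * (A * q) := by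
    intro ε hε hερ
    set k : (Fin n → ℂ) → (Fin n → ℂ) → ℂ := fun x z => ∑ i, dbar i χ x *
      MvPolynomial.eval x P * (cofactorField (S.sec z) i x * (S.den ε z x)⁻¹ ^ n) with hk
    have hkc : ContinuousOn (fun p : (Fin n → ℂ) × (Fin n → ℂ) => k p.1 p.2)
        (Set.univ ×ˢ polyHull n K) := by
      refine continuousOn_finsetSum _ fun i _ => ContinuousOn.mul ?_ (ContinuousOn.mul ?_ ?_)
      · exact (((hχ.dbar i).continuous.mul hPc).comp continuous_fst).continuousOn
      · exact (contDiff_cofactorField_uncurry S.contDiff i).continuous.continuousOn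
      · exact ((S.continuous_den ε).continuousOn.inv₀
          fun p hp => S.den_ne_zero hε hp.2 p.1).pow n
    obtain ⟨F, hF, hFk⟩ := exists_integral_mem_polyClosure hT (k := k)
      (hkc.mono (Set.prod_mono_left (Set.subset_univ T))) (by
        intro x hx
        choose g hg hg' using S.mem_polyClosure x hx ε hε
        refine ⟨∑ i, (dbar i χ x * MvPolynomial.eval x P) • g i,
          Subalgebra.sum_mem _ fun i _ => Subalgebra.smul_mem _ (hg i) _, fun z => ?_⟩
        rw [ContinuousMap.sum_apply]
        refine Finset.sum_congr rfl fun i _ => ?_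
        rw [ContinuousMap.smul_apply, hg' i z, smul_eq_mul]
        rfl)
    have hkA : ∀ z ∈ polyHull n K, ‖∫ x in Tᶜ, k x z‖ ≤ A * q := fun z hz =>
      hA Tᶜ _ hT.measurableSet.compl q hq
        (fun x hx i hd => hPW x (hχT x hx i hd)) ε hε z hz
    have hsplit : ∀ z : polyHull n K, F z + ∫ x in Tᶜ, k x z = -(n * S.solid G ε z) := by
      intro z
      have hi : Integrable fun x => k x z := by
        refine Continuous.integrable_of_hasCompactSupport ?_
          (HasCompactSupport.intro hX fun x hx => ?_)
        · refine continuous_finsetSum _ fun i _ => ((hχ.dbar i).continuous.mul hPc).mul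
            ((contDiff_cofactorField i (S.contDiff_sec z)).continuous.mul (Continuous.pow ?_ n))
          exact ((S.continuous_den ε).comp (Continuous.prodMk_left z.1)).inv₀
            fun x => S.den_ne_zero hε z.2 x
        · simp [hk, dbar_eq_zero_of_notMem_tsupport _ fun h => hx (hχX h)]
      rw [hFk, integral_add_compl hT.measurableSet hi, LeraySection.solid, ← mul_assoc]
      refine Eq.trans ?_ (cauchy_fantappie hGs hGc (S.contDiff_sec z) z ε
        fun x => S.den_ne_zero hε z.2 x)
      simp only [hdG, hk, LeraySection.den]
    have hFK : ∀ w : polyHull n K, w.1 ∈ K → ‖F w‖ ≤ n * (L * q + ε * (L' * M)) + A * q := by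
      intro w hw
      rw [eq_sub_of_add_eq (hsplit w)]
      refine (norm_sub_le _ _).trans (add_le_add ?_ (hkA w w.2))
      rw [norm_neg, norm_mul, Complex.norm_natCast]
      exact mul_le_mul_of_nonneg_left (hL' G q M hq hM0 hGX hM w w.2 (hGq w hw) ε hε) hn'.le
    have h1 := norm_apply_le_of_mem_polyClosure (nonempty_of_mem_polyHull hz₀)
      (subset_polyHull hK) hF (z := ⟨z₀, hz₀⟩) hz₀ hFK
    have h2 := hB G M hGs.continuous hM0 hGX hM
      (fun x hx => by simpa [hG, (hρ' hx).2.1] using (hρ' hx).2.2) ε hε hερ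
    have h3 : n * ‖S.solid G ε z₀‖ ≤ ‖F ⟨z₀, hz₀⟩‖ + A * q := by
      have h4 := (norm_add_le (F ⟨z₀, hz₀⟩) (∫ x in Tᶜ, k x z₀)).trans
        (add_le_add_right (hkA z₀ hz₀) _)
      rwa [hsplit ⟨z₀, hz₀⟩, norm_neg, norm_mul, Complex.norm_natCast] at h4
    have h5 := mul_le_mul_of_nonneg_left h2 hn'.le
    linarith
  have t1 : Tendsto (fun ε : ℝ => n * (a - ε * (B * M))) (𝓝[>] 0) (𝓝 (n * (a - 0 * (B * M)))) :=
    (Continuous.tendsto (by fun_prop) 0).mono_left nhdsWithin_le_nhds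
  have t2 : Tendsto (fun ε : ℝ => n * (L * q + ε * (L' * M)) + 2 * (A * q)) (𝓝[>] 0)
      (𝓝 (n * (L * q + 0 * (L' * M)) + 2 * (A * q))) :=
    (Continuous.tendsto (by fun_prop) 0).mono_left nhdsWithin_le_nhds
  have hlim := le_of_tendsto_of_tendsto t1 t2 (by
    filter_upwards [self_mem_nhdsWithin,
      mem_nhdsWithin_of_mem_nhds (Iio_mem_nhds (by positivity : (0 : ℝ) < ρ ^ 2))] with ε hε hερ
    exact key ε hε ((Real.sqrt_lt' hρ).2 hερ))
  rw [div_mul_eq_mul_div, le_div_iff₀ (by positivity)]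
  linarith

open Filter Topology in
lemma exists_one_le_mul_of_trc_subset (hn : 1 ≤ n) {K W : Set (Fin n → ℂ)} (hK : IsCompact K)
    (hW : IsOpen W) (htrc : trc n K ⊆ W) {z₀ : Fin n → ℂ} (hz₀ : z₀ ∈ essHull n K)
    (hz₀W : z₀ ∉ W) :
    ∃ C : ℝ, ∀ (P : MvPolynomial (Fin n) ℂ) (q : ℝ), 0 ≤ q →
      (∀ x ∈ W, ‖MvPolynomial.eval x P‖ ≤ q) → MvPolynomial.eval z₀ P = 1 → 1 ≤ C * q := by
  have hH : IsCompact (polyHull n K) := isCompact_polyHull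
  have : CompactSpace (polyHull n K) := isCompact_iff_compactSpace.1 hH
  have hess : essHull n K ⊆ polyHull n K := closure_minimal Set.sdiff_subset hH.isClosed
  have hC₁ : IsCompact (essHull n K \ W) := (hH.of_isClosed_subset isClosed_closure hess).diff hW
  have hC₀ : IsCompact (K \ W) := hK.diff hW
  obtain ⟨V, hV, hV₁, hV₀⟩ := exists_compact_between hC₁ hC₀.isClosed.isOpen_compl
    (fun x hx hx' => hx.2 (htrc ⟨hx.1, hx'.1⟩))
  obtain ⟨f, hf₁, hf₀, hf⟩ := exists_contMDiffMap_one_nhds_of_subset_interior (n := (⊤ : ℕ∞))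
    (modelWithCornersSelf ℝ (Fin n → ℂ)) hC₁.isClosed hV₁
  let χ : (Fin n → ℂ) → ℂ := fun x => (f x : ℂ)
  have hχ : ContDiff ℝ ∞ χ := ofRealCLM.contDiff.comp f.contMDiff.contDiff
  have hχV : tsupport χ ⊆ V := closure_minimal
    (fun x hx => by_contra fun h => hx (by simp [χ, hf₀ x h])) hV.isClosed
  have hχ₁ : ∀ x ∈ essHull n K \ W, ∀ᶠ y in 𝓝 x, χ y = 1 := fun x hx =>
    (hf₁.filter_mono (nhds_le_nhdsSet hx)).mono fun y hy => by simp [χ, hy]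
  set D := closure {x | ∃ i, dbar i χ x ≠ 0} with hD
  have hDV : D ⊆ V := by
    refine (closure_minimal ?_ (isClosed_tsupport χ)).trans hχV
    rintro x ⟨i, hi⟩
    exact by_contra fun h => hi (dbar_eq_zero_of_notMem_tsupport i h)
  have hT : IsCompact (D \ W) := (hV.of_isClosed_subset isClosed_closure hDV).diff hW
  have hTH : Disjoint (D \ W) (polyHull n K) := by
    refine Set.disjoint_left.2 fun x hx hxH => ?_
    by_cases hxK : x ∈ K
    · exact hV₀ (hDV hx.1) ⟨hxK, hx.2⟩
    · have h := (hχ₁ x ⟨subset_closure ⟨hxH, hxK⟩, hx.2⟩).eventually_nhds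
      obtain ⟨y, ⟨i, hi⟩, hy⟩ := ((mem_closure_iff_frequently.1 hx.1).and_eventually h).exists
      exact hi ((dbar_congr i hy).trans (dbar_const i 1))
  obtain ⟨S⟩ := exists_leraySection hK (nonempty_of_mem_polyHull (hess hz₀)) hV hT hTH
  refine exists_one_le_mul_of_leraySection hn hK hV hT hW S hχ hχV (fun x => ?_)
    (fun x hx i hi => by_contra fun h => hx ⟨subset_closure ⟨i, hi⟩, h⟩)
    (fun x hx hxχ => by_contra fun h => hV₀ (hχV hxχ) ⟨hx, h⟩) (hess hz₀)
    (hχ₁ z₀ ⟨hz₀, hz₀W⟩)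
  simp only [χ, Complex.norm_real, Real.norm_of_nonneg (hf x).1]
  exact (hf x).2

end trace

end hullTrace

/-- For every compact set `K ⊆ ℂⁿ`, the essential hull of `K` is contained in the
polynomial hull of the trace of `K`. -/
theorem essHull_subset_polyHull_trc (n : ℕ) (K : Set (Fin n → ℂ)) (hK : IsCompact K) :
    essHull n K ⊆ polyHull n (trc n K) := by
  intro z hz P
  by_contra! hlt
  obtain ⟨m, hm, hmz⟩ := exists_between hlt
  have hPc := (continuous_eval_mvPolynomial P).norm
  have hm0 : 0 ≤ m := le_trans (Real.sSup_nonneg (by rintro _ ⟨w, -, rfl⟩; positivity)) hm.le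
  obtain ⟨z₀, hz₀m, hz₀⟩ := mem_closure_iff.1 hz _ (isOpen_lt continuous_const hPc) hmz
  have hz₀m : m < ‖MvPolynomial.eval z₀ P‖ := hz₀m
  have hpos : 0 < ‖MvPolynomial.eval z₀ P‖ := hm0.trans_lt hz₀m
  have hn : 1 ≤ n := by
    rcases Nat.eq_zero_or_pos n with rfl | h
    · obtain ⟨w, hw⟩ := nonempty_of_mem_polyHull hz₀.1
      exact absurd (Subsingleton.elim w z₀ ▸ hw) hz₀.2
    · exact h
  have htrc : trc n K ⊆ {x | ‖MvPolynomial.eval x P‖ < m} := fun x hx =>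
    (le_csSup ((bddAbove_norm_eval hK P).mono (Set.image_mono Set.inter_subset_right))
      ⟨x, hx, rfl⟩).trans_lt hm
  obtain ⟨C, hC⟩ := exists_one_le_mul_of_trc_subset hn hK (isOpen_lt hPc continuous_const) htrc
    (subset_closure hz₀) (fun h => lt_asymm h hz₀m)
  set q := m / ‖MvPolynomial.eval z₀ P‖
  have hq0 : 0 ≤ q := by positivity
  have hq1 : q < 1 := (div_lt_one hpos).2 hz₀m
  have hk : ∀ k : ℕ, 1 ≤ C * q ^ k := fun k => by
    refine hC ((MvPolynomial.C (MvPolynomial.eval z₀ P)⁻¹ * P) ^ k) (q ^ k) (by positivity)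
      (fun x hx => ?_) ?_
    · rw [map_pow, map_mul, MvPolynomial.eval_C, norm_pow, norm_mul, norm_inv, mul_comm,
        ← div_eq_mul_inv]
      have hx : ‖MvPolynomial.eval x P‖ < m := hx
      gcongr
      exact div_le_div_of_nonneg_right hx.le hpos.le
    · rw [map_pow, map_mul, MvPolynomial.eval_C, inv_mul_cancel₀ (norm_pos_iff.1 hpos), one_pow]
  have hlim := (tendsto_pow_atTop_nhds_zero_of_lt_one hq0 hq1).const_mul C
  have := ge_of_tendsto' hlim hk
  norm_num at this
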